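/- Let φ be an anisotropic quadratic form of type (r,s) over F with r ≥ 1, and write dim φ = 2^n + m with n ≥ 0 and 1 ≤ m ≤ 2^n. Suppose r + s ≤ 2^n. If φ has nondefective height 1 (h_nd(φ) = 1), then dim φ = 2^{n+1} − s. -/

import Mathlib

/-!  Common framework: quadratic forms over a field of characteristic 2, presented by
coefficient matrices, together with the standard invariants used in the paper
"Rationality of cycles modulo 2 on products of generically smooth quadrics in
characteristic 2" by S. Scully and G. Zhu. -/

open scoped TensorProduct

/-- A quadratic form of dimension `n` over `F`, presented by an `n × n` coefficient
matrix `q`: the associated quadratic form is `x ↦ ∑ i j, q i j * x i * x j`. -/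
abbrev QF (F : Type) (n : ℕ) := Matrix (Fin n) (Fin n) F

namespace QF

section Basic

variable {F : Type} [Field F]

/-- The value of a quadratic form at a vector. -/
def eval {n : ℕ} (q : QF F n) (x : Fin n → F) : F := ∑ i, ∑ j, q i j * x i * x j

/-- The polar bilinear form of `q`. -/
def polar {n : ℕ} (q : QF F n) (x y : Fin n → F) : F :=
  eval q (x + y) - eval q x - eval q y

/-- `q` is isotropic: it vanishes at some nonzero vector. -/
def Isotropic {n : ℕ} (q : QF F n) : Prop := ∃ x, x ≠ 0 ∧ eval q x = 0

/-- `q` is anisotropic: it vanishes only at `0`. -/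
def Anisotropic {n : ℕ} (q : QF F n) : Prop := ∀ x, eval q x = 0 → x = 0

/-- The zero form `d ⬝ ⟨0⟩` of dimension `d`. -/
def zeroForm (d : ℕ) : QF F d := 0

/-- Isometry of quadratic forms. -/
def Isom {n m : ℕ} (q : QF F n) (q' : QF F m) : Prop :=
  ∃ e : (Fin n → F) ≃ₗ[F] (Fin m → F), ∀ x, eval q' (e x) = eval q x

/-- Orthogonal sum of quadratic forms. -/
def orthSum {n m : ℕ} (q : QF F n) (q' : QF F m) : QF F (n + m) :=
  Matrix.reindex finSumFinEquiv finSumFinEquiv (Matrix.fromBlocks q 0 0 q')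

/-- The binary quadratic form `[a, b] : (x, y) ↦ a x² + x y + b y²`. -/
def binary (a b : F) : QF F 2 := !![a, 1; 0, b]

/-- The orthogonal sum of the binary forms `[a i, b i]`, `i = 0, …, r - 1`. -/
def binSum {r : ℕ} (a b : Fin r → F) : QF F (r + r) :=
  Matrix.reindex finSumFinEquiv finSumFinEquiv
    (Matrix.fromBlocks (Matrix.diagonal a) 1 0 (Matrix.diagonal b))

/-- The split form `w ⬝ ℍ`, the orthogonal sum of `w` hyperbolic planes. -/
def hyper (w : ℕ) : QF F (w + w) := binSum 0 0

/-- The quasilinear (diagonal) quadratic form `⟨c 0, …, c (s - 1)⟩`. -/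
def diag {s : ℕ} (c : Fin s → F) : QF F s := Matrix.diagonal c

/-- `q` has type `(r, s)` with quasilinear part `⟨c⟩`, i.e.
`q ≃ [a 0, b 0] ⊥ ⋯ ⊥ [a (r-1), b (r-1)] ⊥ ⟨c⟩` for some `a b`. -/
def HasTypeWith {n : ℕ} (q : QF F n) (r s : ℕ) (c : Fin s → F) : Prop :=
  ∃ a b : Fin r → F, Isom q (orthSum (binSum a b) (diag c))

/-- `q` has type `(r, s)`. -/
def HasType {n : ℕ} (q : QF F n) (r s : ℕ) : Prop := ∃ c : Fin s → F, HasTypeWith q r s c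

/-- `q` is quasilinear, i.e. isometric to a diagonal form. -/
def IsQuasilinear {n : ℕ} (q : QF F n) : Prop := ∃ c : Fin n → F, Isom q (diag c)

/-- The isotropy index `i₀(q)`: the maximal dimension of a totally isotropic subspace. -/
noncomputable def i0 {n : ℕ} (q : QF F n) : ℕ :=
  sSup {d | ∃ W : Submodule F (Fin n → F), Module.finrank F W = d ∧ ∀ x ∈ W, eval q x = 0}

/-- The defect index `i_d(q)`: the maximal dimension of a totally isotropic subspace
contained in the radical of the polar form (equivalently, the isotropy index of the
quasilinear part of `q`, in characteristic 2). -/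
noncomputable def defect {n : ℕ} (q : QF F n) : ℕ :=
  sSup {d | ∃ W : Submodule F (Fin n → F), Module.finrank F W = d ∧
    (∀ x ∈ W, eval q x = 0) ∧ ∀ x ∈ W, ∀ y, polar q x y = 0}

/-- `q` is nondefective. -/
def Nondefective {n : ℕ} (q : QF F n) : Prop := defect q = 0

/-- The Witt index `i_W(q)`: the maximal number of hyperbolic planes splitting off `q`. -/
noncomputable def wittIndex {n : ℕ} (q : QF F n) : ℕ :=
  sSup {w | ∃ (m : ℕ) (q' : QF F m), Isom q (orthSum q' (hyper w))}

/-- `qa` is the anisotropic part of `q`: `qa` is anisotropic and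
`q ≃ qa ⊥ w ⬝ ℍ ⊥ d ⬝ ⟨0⟩` (Witt decomposition). -/
def IsAnisotropicPart {n m : ℕ} (q : QF F n) (qa : QF F m) : Prop :=
  Anisotropic qa ∧ ∃ w d : ℕ, Isom q (orthSum (orthSum qa (hyper w)) (zeroForm d))

/-- Witt equivalence: `q` and `q'` have isometric anisotropic parts. -/
def WittEquiv {n m : ℕ} (q : QF F n) (q' : QF F m) : Prop :=
  ∃ (k : ℕ) (qa : QF F k), IsAnisotropicPart q qa ∧ IsAnisotropicPart q' qa

/-- `p` is dominated by `q` (`p ≺ q`): `p` is isometric to the restriction of `q` to a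
subspace of the underlying space of `q`. -/
def Dominated {m n : ℕ} (p : QF F m) (q : QF F n) : Prop :=
  ∃ f : (Fin m → F) →ₗ[F] (Fin n → F), Function.Injective f ∧ ∀ x, eval q (f x) = eval p x

/-- `p` is a subform (orthogonal direct summand) of `q`. -/
def Subform {m n : ℕ} (p : QF F m) (q : QF F n) : Prop :=
  ∃ (k : ℕ) (p' : QF F k), Isom q (orthSum p p')

/-- Base change of a quadratic form along a field extension `K/F`. -/
def baseChange {n : ℕ} (q : QF F n) (K : Type) [Field K] [Algebra F K] : QF K n :=
  q.map (algebraMap F K)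

/-- Transport a quadratic form along an equality of dimensions. -/
def castQF {n m : ℕ} (h : n = m) (q : QF F n) : QF F m :=
  Matrix.reindex (finCongr h) (finCongr h) q

/-- The orthogonal sum of the first `h` members of a family of quadratic forms. -/
noncomputable def sumFam {D : ℕ → ℕ} (f : ∀ i, QF F (D i)) :
    (h : ℕ) → QF F (∑ i ∈ Finset.range h, D i)
  | 0 => castQF (by simp) (zeroForm 0)
  | h + 1 => castQF (Finset.sum_range_succ D h).symm (orthSum (sumFam f h) (f h))

/-- The Gram matrix of the `k`-fold bilinear Pfister form `⟪a 0, …, a (k-1)⟫_b`. -/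
noncomputable def bPfister {k : ℕ} (a : Fin k → F) :
    Matrix (Fin (2 ^ k)) (Fin (2 ^ k)) F :=
  Matrix.reindex finFunctionFinEquiv finFunctionFinEquiv
    (Matrix.diagonal fun f : Fin k → Fin 2 => ∏ i, if f i = 1 then a i else 1)

/-- The `(k+1)`-fold quadratic Pfister form `⟪a 0, …, a (k-1)⟫_b ⊗ [1, c]`. -/
noncomputable def qPfister {k : ℕ} (a : Fin k → F) (c : F) : QF F (2 ^ k * 2) :=
  Matrix.reindex finProdFinEquiv finProdFinEquiv
    (Matrix.kroneckerMap (· * ·) (bPfister a) (binary 1 c))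

/-- `π` is a `(k+1)`-fold quadratic Pfister form. -/
def IsPfister {m : ℕ} (k : ℕ) (π : QF F m) : Prop :=
  ∃ (a : Fin k → F) (c : F), Isom π (qPfister a c)

/-- `π` is a general `(k+1)`-fold Pfister form: a nonzero scalar multiple of a
`(k+1)`-fold quadratic Pfister form. -/
def IsGenPfister {m : ℕ} (k : ℕ) (π : QF F m) : Prop :=
  ∃ d : F, d ≠ 0 ∧ ∃ (a : Fin k → F) (c : F), Isom π (d • qPfister a c)

/-- `q` is a Pfister neighbour: `2 ^ k < dim q ≤ 2 ^ (k + 1)` and `q` is dominated by a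
general `(k+1)`-fold Pfister form (domination forces `dim q ≤ 2 ^ (k + 1)`). -/
def IsPfisterNeighbour {n : ℕ} (q : QF F n) : Prop :=
  ∃ (k : ℕ) (π : QF F (2 ^ k * 2)), 2 ^ k < n ∧ IsGenPfister k π ∧ Dominated q π

/-- `qc` is the complementary form of the Pfister neighbour `q` in its ambient general
Pfister form `π`: it is the nondefective form of dimension `2 ^ (k + 1) - dim q` which is
Witt equivalent to `q ⊥ π` (this pins down `qc` up to isometry). -/
def IsComplement {n k m : ℕ} (q : QF F n) (π : QF F (2 ^ k * 2)) (qc : QF F m) : Prop :=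
  m = 2 ^ k * 2 - n ∧ Nondefective qc ∧ WittEquiv (orthSum q π) qc

/-- `qc` is the complementary form of the Pfister neighbour `q`. -/
def IsComplementOf {n m : ℕ} (q : QF F n) (qc : QF F m) : Prop :=
  ∃ (k : ℕ) (π : QF F (2 ^ k * 2)), 2 ^ k < n ∧ IsGenPfister k π ∧ Dominated q π ∧
    IsComplement q π qc

/-- The polynomial of the quadric `{q = 0}` in the affine chart where the last
projective coordinate equals `1`. -/
noncomputable def affinePoly {n : ℕ} (q : QF F n) : MvPolynomial (Fin (n - 1)) F :=
  ∑ i : Fin n, ∑ j : Fin n,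
    MvPolynomial.C (q i j) *
      (if h : (i : ℕ) < n - 1 then MvPolynomial.X (⟨(i : ℕ), h⟩ : Fin (n - 1)) else 1) *
      (if h : (j : ℕ) < n - 1 then MvPolynomial.X (⟨(j : ℕ), h⟩ : Fin (n - 1)) else 1)

/-- `K` is a model of the function field `F(q)` of the projective quadric `{q = 0}`:
`K` is the fraction field of the affine coordinate ring of the (dense) standard affine
chart of the quadric. -/
def IsFunctionField {n : ℕ} (q : QF F n) (K : Type) [Field K] [Algebra F K] : Prop :=
  ∃ f : MvPolynomial (Fin (n - 1)) F →ₐ[F] K,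
    RingHom.ker f = Ideal.span {affinePoly q} ∧
    IntermediateField.adjoin F (Set.range fun i => f (MvPolynomial.X i)) = ⊤

end Basic

/-- A bundled field extension of `F`. -/
structure FieldExt (F : Type) [Field F] : Type 1 where
  carrier : Type
  [fieldInst : Field carrier]
  [algInst : Algebra F carrier]

attribute [instance] FieldExt.fieldInst FieldExt.algInst

/-- `K/F` is a separable field extension (MacLane's criterion: `K ⊗_F L` is reduced for
every purely inseparable extension `L/F`). -/
def IsSepExt (F : Type) [Field F] (K : Type) [Field K] [Algebra F K] : Prop :=
  ∀ (L : Type) [Field L] [Algebra F L], IsPurelyInseparable F L → IsReduced (K ⊗[F] L)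

/-- `K/F` is purely transcendental: `K` is generated over `F` by an algebraically
independent subset. -/
def IsPurelyTranscendentalExt (F : Type) [Field F] (K : Type) [Field K] [Algebra F K] :
    Prop :=
  ∃ s : Set K, AlgebraicIndependent F (fun x : s => (x : K)) ∧
    IntermediateField.adjoin F s = ⊤

section Invariants

variable {F : Type} [Field F]

/-- `p` and `q` are stably birationally equivalent: over every field extension of `F`,
`p` is isotropic if and only if `q` is (for anisotropic forms of dimension at least 2
this is equivalent to stable birationality of the associated projective quadrics). -/
def SBEquiv {m n : ℕ} (p : QF F m) (q : QF F n) : Prop :=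
  ∀ (K : Type) [Field K] [Algebra F K],
    (Isotropic (baseChange p K) ↔ Isotropic (baseChange q K))

/-- The first higher isotropy index `i₁(q)` of an anisotropic form: the minimal positive
isotropy index attained over field extensions of `F`. -/
noncomputable def i1 {n : ℕ} (q : QF F n) : ℕ :=
  sInf {i | 0 < i ∧ ∃ K : FieldExt F, i0 (baseChange q K.carrier) = i}

/-- The Izhboldin dimension `dim q - i₁(q)`. -/
noncomputable def izh {n : ℕ} (q : QF F n) : ℕ := n - i1 q

/-- The nondefective splitting pattern of a nondefective form `q`: the set of Witt
indices attained by `q` over separable field extensions of `F`. -/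
def splittingPattern {n : ℕ} (q : QF F n) : Set ℕ :=
  {w | ∃ K : FieldExt F, IsSepExt F K.carrier ∧ wittIndex (baseChange q K.carrier) = w}

/-- The nondefective height `h_nd(q)`. -/
noncomputable def hnd {n : ℕ} (q : QF F n) : ℕ := (splittingPattern q).ncard - 1

/-- `jrel q t = j_t(q)`: the `t`-th value (in increasing order) of the nondefective
splitting pattern of `q`. -/
noncomputable def jrel {n : ℕ} (q : QF F n) (t : ℕ) : ℕ :=
  sInf {w | w ∈ splittingPattern q ∧ {w' | w' ∈ splittingPattern q ∧ w' < w}.ncard = t}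

/-- `irel q t = i_t(q) = j_t(q) - j_(t-1)(q)`: the `t`-th higher Witt index of `q`. -/
noncomputable def irel {n : ℕ} (q : QF F n) (t : ℕ) : ℕ := jrel q t - jrel q (t - 1)

/-- `q` is a virtual Pfister neighbour: it becomes an anisotropic Pfister neighbour
over some field extension of `F`. -/
def IsVirtualPfisterNeighbour {n : ℕ} (q : QF F n) : Prop :=
  ∃ K : FieldExt F, Anisotropic (baseChange q K.carrier) ∧
    IsPfisterNeighbour (baseChange q K.carrier)

end Invariants

/-! ### The combinatorics of `Λ(X)` and the motivic decomposition type -/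

/-- Formal symbols `i_lo` and `iᵘᵖ` indexing the Tate motives of a split quadric. -/
inductive Sym : Type
  | lo : ℤ → Sym
  | up : ℤ → Sym
  deriving DecidableEq

/-- Shift of a symbol by `j`. -/
def Sym.shift (j : ℤ) : Sym → Sym
  | .lo i => .lo (i + j)
  | .up i => .up (i + j)

/-- The shift `Λ[j]` of a set of symbols. -/
def shiftSet (Λ : Set Sym) (j : ℤ) : Set Sym := Sym.shift j '' Λ

/-- The set `Λ(X)` for a quadric `X` of dimension `d` attached to a form of type
`(r, s)`: the symbols `i_lo` for `0 ≤ i < r` and `iᵘᵖ` for `d - r < i ≤ d`. -/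
def LamSet (r d : ℤ) : Set Sym :=
  {x | (∃ i : ℤ, x = Sym.lo i ∧ 0 ≤ i ∧ i < r) ∨ ∃ i : ℤ, x = Sym.up i ∧ d - r < i ∧ i ≤ d}

/-- `a(Λ) = m`: `m` is the least index `i` with `i_lo ∈ Λ`. -/
def IsALower (Λ : Set Sym) (m : ℤ) : Prop :=
  Sym.lo m ∈ Λ ∧ ∀ i : ℤ, Sym.lo i ∈ Λ → m ≤ i

/-- `b(Λ) = m`: `m` is the largest index `i` with `iᵘᵖ ∈ Λ`. -/
def IsBUpper (Λ : Set Sym) (m : ℤ) : Prop :=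
  Sym.up m ∈ Λ ∧ ∀ i : ℤ, Sym.up i ∈ Λ → i ≤ m

/-- The member of a partition `M` of `Λ(X)` containing `0_lo`: the upper connected
component `Λᵁ(X)`. -/
def upperComp (M : Set (Set Sym)) : Set Sym := ⋃₀ {Λ | Λ ∈ M ∧ Sym.lo 0 ∈ Λ}

/-- An abstract theory of `F`-rational algebraic cycles modulo 2 of middle dimension on
the squares of generically smooth nondefective quadrics, as constructed in §§4–7 of the
paper: `RatCyc K q` is the family of subsets `Λ ⊆ Λ(X_q)` whose associated cycle
`α_Λ = ∑_{λ ∈ Λ} α_λ` is an `F`-rational element of `Ch̄_{d_X}(X_q²)` (the image of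
`CH_{d_X}(X_q²)/2 → CH_{d_X}((X_q²)_F̄)/2`).  The formal properties recorded here are
those established in the paper: the family is an `𝔽₂`-subspace (closed under symmetric
difference), is closed under intersections, consists of subsets of `Λ(X_q)`, and
contains `Λ(X_q)` itself. -/
structure MDTTheory : Type 1 where
  RatCyc : ∀ (K : Type) [Field K] {n : ℕ} (q : QF K n), Set (Set Sym)
  inter_mem : ∀ (K : Type) [Field K] {n : ℕ} (q : QF K n),
    ∀ Λ₁ ∈ RatCyc K q, ∀ Λ₂ ∈ RatCyc K q, Λ₁ ∩ Λ₂ ∈ RatCyc K q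
  symmDiff_mem : ∀ (K : Type) [Field K] {n : ℕ} (q : QF K n),
    ∀ Λ₁ ∈ RatCyc K q, ∀ Λ₂ ∈ RatCyc K q, symmDiff Λ₁ Λ₂ ∈ RatCyc K q
  subset_lam : ∀ (K : Type) [Field K] {n : ℕ} (q : QF K n) (r s : ℕ),
    HasType q r s → ∀ Λ ∈ RatCyc K q, Λ ⊆ LamSet (r : ℤ) ((n : ℤ) - 2)
  lam_mem : ∀ (K : Type) [Field K] {n : ℕ} (q : QF K n) (r s : ℕ),
    HasType q r s → LamSet (r : ℤ) ((n : ℤ) - 2) ∈ RatCyc K q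

/-- The motivic decomposition type `MDT(q)`: the partition of `Λ(X_q)` into the supports
of the indecomposable rational cycles, i.e. the minimal nonempty members of the family
of rational subsets. -/
def MDTTheory.MDT (T : MDTTheory) (K : Type) [Field K] {n : ℕ} (q : QF K n) :
    Set (Set Sym) :=
  {Λ | Λ ∈ T.RatCyc K q ∧ Λ.Nonempty ∧
    ∀ Λ' ∈ T.RatCyc K q, Λ' ⊆ Λ → Λ' = ∅ ∨ Λ' = Λ}

end QF

namespace HS
open Matrix

section Basic
variable {ι κ : Type} [Fintype ι] [Fintype κ] {A B : Type} [CommRing A] [CommRing B]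

/-- value of the quadratic form with coefficient matrix `q` -/
def ev (q : Matrix ι ι A) (x : ι → A) : A := x ⬝ᵥ (q *ᵥ x)

/-- polar form -/
def bl (q : Matrix ι ι A) (x y : ι → A) : A := x ⬝ᵥ (q *ᵥ y) + y ⬝ᵥ (q *ᵥ x)

/-- anisotropic -/
def An (q : Matrix ι ι A) : Prop := ∀ x, ev q x = 0 → x = 0

lemma ev_zero (q : Matrix ι ι A) : ev q 0 = 0 := by simp [ev]

lemma ev_add (q : Matrix ι ι A) (x y : ι → A) : ev q (x + y) = ev q x + ev q y + bl q x y := by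
  simp only [ev, bl, mulVec_add, dotProduct_add, add_dotProduct]; ring

lemma ev_smul (q : Matrix ι ι A) (a : A) (x : ι → A) : ev q (a • x) = a ^ 2 * ev q x := by
  simp only [ev, mulVec_smul, dotProduct_smul, smul_dotProduct, smul_eq_mul]; ring

lemma bl_comm (q : Matrix ι ι A) (x y : ι → A) : bl q x y = bl q y x := by
  simp only [bl]; ring

lemma bl_add_left (q : Matrix ι ι A) (x y z : ι → A) : bl q (x + y) z = bl q x z + bl q y z := by
  simp only [bl, mulVec_add, dotProduct_add, add_dotProduct]; ring

lemma bl_add_right (q : Matrix ι ι A) (x y z : ι → A) : bl q x (y + z) = bl q x y + bl q x z := by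
  simp only [bl, mulVec_add, dotProduct_add, add_dotProduct]; ring

lemma bl_smul_left (q : Matrix ι ι A) (a : A) (x y : ι → A) : bl q (a • x) y = a * bl q x y := by
  simp only [bl, mulVec_smul, dotProduct_smul, smul_dotProduct, smul_eq_mul]; ring

lemma bl_smul_right (q : Matrix ι ι A) (a : A) (x y : ι → A) : bl q x (a • y) = a * bl q x y := by
  simp only [bl, mulVec_smul, dotProduct_smul, smul_dotProduct, smul_eq_mul]; ring

lemma bl_zero_left (q : Matrix ι ι A) (y : ι → A) : bl q 0 y = 0 := by simp [bl]
lemma bl_zero_right (q : Matrix ι ι A) (y : ι → A) : bl q y 0 = 0 := by simp [bl]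

lemma bl_self (q : Matrix ι ι A) (x : ι → A) : bl q x x = 2 * ev q x := by
  simp only [bl, ev]; ring

lemma ev_map (f : A →+* B) (q : Matrix ι ι A) (x : ι → A) :
    ev (q.map f) (fun i => f (x i)) = f (ev q x) := by
  simp [ev, dotProduct, mulVec, map_sum]

lemma bl_map (f : A →+* B) (q : Matrix ι ι A) (x y : ι → A) :
    bl (q.map f) (fun i => f (x i)) (fun i => f (y i)) = f (bl q x y) := by
  simp [bl, dotProduct, mulVec, map_sum]

/-- the polar form as a bilinear map -/
def blm (q : Matrix ι ι A) : (ι → A) →ₗ[A] (ι → A) →ₗ[A] A :=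
  LinearMap.mk₂ A (bl q) (bl_add_left q) (fun c x y => bl_smul_left q c x y) (bl_add_right q)
    (fun c x y => bl_smul_right q c x y)

@[simp] lemma blm_apply (q : Matrix ι ι A) (x y : ι → A) : blm q x y = bl q x y := rfl

lemma ev_smul_mat (q : Matrix ι ι A) (a : A) (x : ι → A) : ev (a • q) x = a * ev q x := by
  simp [ev, smul_mulVec]

lemma bl_smul_mat (q : Matrix ι ι A) (a : A) (x y : ι → A) : bl (a • q) x y = a * bl q x y := by
  simp [bl, smul_mulVec]; ring

lemma ev_fromBlocks (q : Matrix ι ι A) (r : Matrix κ κ A) (x : ι → A) (y : κ → A) :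
    ev (fromBlocks q 0 0 r) (Sum.elim x y) = ev q x + ev r y := by
  simp [ev, fromBlocks_mulVec, sumElim_dotProduct_sumElim]

lemma bl_fromBlocks (q : Matrix ι ι A) (r : Matrix κ κ A) (x x' : ι → A) (y y' : κ → A) :
    bl (fromBlocks q 0 0 r) (Sum.elim x y) (Sum.elim x' y') = bl q x x' + bl r y y' := by
  simp [bl, fromBlocks_mulVec, sumElim_dotProduct_sumElim]; ring

lemma an_iff_of_iso_not {q : Matrix ι ι A} : ¬ An q ↔ ∃ x, x ≠ 0 ∧ ev q x = 0 := by
  unfold An; push Not; constructor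
  · rintro ⟨x, h1, h2⟩; exact ⟨x, h2, h1⟩
  · rintro ⟨x, h1, h2⟩; exact ⟨x, h2, h1⟩

lemma not_an_map {K L : Type} [Field K] [Field L] (f : K →+* L) {q : Matrix ι ι K} (h : ¬ An q) :
    ¬ An (q.map f) := by
  rw [an_iff_of_iso_not] at *
  obtain ⟨x, h1, h2⟩ := h
  refine ⟨fun i => f (x i), ?_, by rw [ev_map, h2, map_zero]⟩
  contrapose! h1
  funext i
  have := congrFun h1 i
  simpa using this

lemma an_of_map {K L : Type} [Field K] [Field L] (f : K →+* L) {q : Matrix ι ι K}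
    (h : An (q.map f)) : An q := by
  by_contra h'; exact not_an_map f h' h

end Basic

section Poly
variable {ι : Type} [Fintype ι] {A : Type} [CommRing A] [IsDomain A]
open Polynomial

lemma divX_smul (x : ι → A[X]) (h : ∀ i, (x i).coeff 0 = 0) :
    x = (X : A[X]) • (fun i => (x i).divX) := by
  funext i
  have := divX_mul_X_add (x i)
  rw [h i] at this
  simp only [Pi.smul_apply, smul_eq_mul]
  rw [mul_comm]; simpa using this.symm

lemma coeff_zero_ev (q : Matrix ι ι A) (x : ι → A[X]) :
    (ev (q.map C) x).coeff 0 = ev q (fun i => (x i).coeff 0) := by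
  have h := ev_map (constantCoeff (R := A)) (q.map C) x
  simp only [constantCoeff_apply] at h
  rw [← h]
  congr 1
  ext i j; simp

lemma an_poly (q : Matrix ι ι A) (h : An q) : An (q.map (C : A →+* A[X])) := by
  have key : ∀ k : ℕ, ∀ x : ι → A[X], ev (q.map C) x = 0 → ∀ i, (x i).coeff k = 0 := by
    intro k
    induction k with
    | zero =>
      intro x hx
      have h1 := coeff_zero_ev q x
      rw [hx] at h1
      exact fun i => congrFun (h _ h1.symm) i
    | succ k ih =>
      intro x hx
      have h1 := coeff_zero_ev q x
      rw [hx] at h1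
      have h2 := divX_smul x (fun i => congrFun (h _ h1.symm) i)
      rw [h2, ev_smul] at hx
      have h3 : ev (q.map C) (fun i => (x i).divX) = 0 := by
        rcases mul_eq_zero.1 hx with h | h
        · exact absurd h (pow_ne_zero _ X_ne_zero)
        · exact h
      intro i
      have := ih _ h3 i
      simpa [coeff_divX] using this
  intro x hx
  funext i
  ext k
  simpa using key k x hx i

lemma an_poly_twist (q : Matrix ι ι A) (h : An q) (u v : ι → A[X])
    (huv : ev (q.map C) u + X * ev (q.map C) v = 0) : u = 0 ∧ v = 0 := by
  have step : ∀ u v : ι → A[X], ev (q.map C) u + X * ev (q.map C) v = 0 →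
      (∀ i, (u i).coeff 0 = 0) ∧ ev (q.map C) v + X * ev (q.map C) (fun i => (u i).divX) = 0 := by
    intro u v huv
    have h1 := congrArg (fun p => p.coeff 0) huv
    simp only [coeff_add, coeff_zero_ev, mul_coeff_zero, coeff_X_zero, zero_mul, add_zero,
      coeff_zero] at h1
    have h2 : ∀ i, (u i).coeff 0 = 0 := fun i => congrFun (h _ h1) i
    refine ⟨h2, ?_⟩
    rw [divX_smul u h2, ev_smul] at huv
    have : X * (ev (q.map C) v + X * ev (q.map C) (fun i => (u i).divX)) = 0 := by
      rw [← huv]; ring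
    rcases mul_eq_zero.1 this with h | h
    · exact absurd h X_ne_zero
    · exact h
  have key : ∀ k : ℕ, ∀ u v : ι → A[X], ev (q.map C) u + X * ev (q.map C) v = 0 →
      ∀ i, (u i).coeff k = 0 ∧ (v i).coeff k = 0 := by
    intro k
    induction k with
    | zero =>
      intro u v huv i
      obtain ⟨h1, h2⟩ := step u v huv
      exact ⟨h1 i, (step _ _ h2).1 i⟩
    | succ k ih =>
      intro u v huv i
      obtain ⟨h1, h2⟩ := step u v huv
      have h3 := (step _ _ h2).2
      have := ih _ _ h3 i
      simpa [coeff_divX] using this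
  constructor <;> funext i <;> ext k
  · simpa using (key k u v huv i).1
  · simpa using (key k u v huv i).2

lemma an_frac {L : Type} [Field L] [Algebra A L] [IsFractionRing A L] (q : Matrix ι ι A)
    (h : An q) : An (q.map (algebraMap A L)) := by
  intro x hx
  obtain ⟨b, hb⟩ := IsLocalization.exist_integer_multiples_of_finite (nonZeroDivisors A) x
  choose y hy using hb
  have hb0 : algebraMap A L b ≠ 0 := by
    intro h0
    have := (IsFractionRing.injective A L) (h0.trans (map_zero _).symm)
    exact nonZeroDivisors.ne_zero b.2 this
  have h1 : (fun i => algebraMap A L (y i)) = (algebraMap A L b) • x := by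
    funext i; rw [hy i]; simp [Algebra.smul_def, Submonoid.smul_def]
  have h2 : algebraMap A L (ev q y) = 0 := by
    rw [← ev_map, h1, ev_smul, hx, mul_zero]
  have h3 : y = 0 := h _ ((IsFractionRing.injective A L) (h2.trans (map_zero _).symm))
  funext i
  have := congrFun h1 i
  simp only [h3, Pi.zero_apply, map_zero, Pi.smul_apply, smul_eq_mul] at this
  rcases mul_eq_zero.1 this.symm with h | h
  · exact absurd h hb0
  · simpa using h

end Poly

section MvPoly
variable {ι : Type} [Fintype ι] {A : Type} [CommRing A] [IsDomain A]

lemma an_equiv {B C : Type} [CommRing B] [CommRing C] (e : B ≃+* C) (q : Matrix ι ι B)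
    (h : An (q.map e)) : An q := by
  intro x hx
  have := h (fun i => e (x i)) (by
    have := ev_map (e : B →+* C) q x
    rw [hx, map_zero] at this
    simpa using this)
  funext i
  have := congrFun this i
  simpa using this

lemma an_mv (q : Matrix ι ι A) (h : An q) (N : ℕ) :
    An (q.map (MvPolynomial.C : A →+* MvPolynomial (Fin N) A)) := by
  induction N with
  | zero =>
    refine an_equiv (MvPolynomial.isEmptyRingEquiv A (Fin 0)) _ ?_
    convert h
    ext i j; simp; exact MvPolynomial.coeff_zero_C _
  | succ N ih =>
    refine an_equiv (MvPolynomial.finSuccEquiv A N).toRingEquiv _ ?_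
    have := an_poly _ ih
    convert this using 1
    ext i j : 2; simp [MvPolynomial.finSuccEquiv_apply]

end MvPoly

end HS

namespace HS
open Matrix

/-- index types of Pfister forms -/
def PI : ℕ → Type
  | 0 => Fin 2
  | n + 1 => PI n ⊕ PI n

instance instFintypePI : (n : ℕ) → Fintype (PI n)
  | 0 => inferInstanceAs (Fintype (Fin 2))
  | n + 1 => @instFintypeSum _ _ (instFintypePI n) (instFintypePI n)

lemma card_PI (n : ℕ) : Fintype.card (PI n) = 2 ^ (n + 1) := by
  induction n with
  | zero => exact Fintype.card_fin 2
  | succ n ih =>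
    have : Fintype.card (PI (n+1)) = Fintype.card (PI n) + Fintype.card (PI n) :=
      Fintype.card_sum
    rw [this, ih]; ring

/-- Pfister forms -/
def pm {A : Type} [CommRing A] (X : ℕ → A) (D : A) : (n : ℕ) → Matrix (PI n) (PI n) A
  | 0 => (!![1, 1; 0, D] : Matrix (Fin 2) (Fin 2) A)
  | n + 1 => (fromBlocks (pm X D n) 0 0 (X n • pm X D n) : Matrix (PI n ⊕ PI n) (PI n ⊕ PI n) A)

lemma pm_map {A B : Type} [CommRing A] [CommRing B] (f : A →+* B) (X : ℕ → A) (D : A) (n : ℕ) :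
    (pm X D n).map f = pm (fun i => f (X i)) (f D) n := by
  induction n with
  | zero =>
    show (!![1, 1; 0, D] : Matrix (Fin 2) (Fin 2) A).map f = !![1, 1; 0, f D]
    ext i j; fin_cases i <;> fin_cases j <;> simp
  | succ n ih =>
    show (fromBlocks (pm X D n) 0 0 (X n • pm X D n)).map f = fromBlocks _ 0 0 (f (X n) • _)
    rw [← ih]
    ext i j
    rcases i with i | i <;> rcases j with j | j <;> simp [fromBlocks]

lemma pm_congr {A : Type} [CommRing A] (X X' : ℕ → A) (D : A) (n : ℕ) (h : ∀ i < n, X i = X' i) :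
    pm X D n = pm X' D n := by
  induction n with
  | zero => rfl
  | succ n ih =>
    show fromBlocks _ 0 0 (X n • _) = fromBlocks _ 0 0 (X' n • _)
    rw [ih (fun i hi => h i (by omega)), h n (by omega)]

lemma ev_pm_zero {A : Type} [CommRing A] (X : ℕ → A) (D : A) (w : Fin 2 → A) :
    ev (ι := PI 0) (pm X D 0) w = w 0 ^ 2 + w 0 * w 1 + D * w 1 ^ 2 := by
  show ev (ι := Fin 2) !![1, 1; 0, D] w = _
  simp [ev, dotProduct, mulVec, Fin.sum_univ_two]; ring

lemma bl_pm_zero {A : Type} [CommRing A] (X : ℕ → A) (D : A) (w v : Fin 2 → A) :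
    bl (ι := PI 0) (pm X D 0) w v = 2 * w 0 * v 0 + w 0 * v 1 + w 1 * v 0 + 2 * D * w 1 * v 1 := by
  show bl (ι := Fin 2) !![1, 1; 0, D] w v = _
  simp [bl, dotProduct, mulVec, Fin.sum_univ_two]; ring

lemma ev_pm_succ {A : Type} [CommRing A] (X : ℕ → A) (D : A) (n : ℕ) (u v : PI n → A) :
    ev (ι := PI (n+1)) (pm X D (n+1)) (Sum.elim u v) = ev (pm X D n) u + X n * ev (pm X D n) v := by
  show ev (ι := PI n ⊕ PI n) (fromBlocks _ 0 0 (X n • _)) _ = _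
  rw [← ev_smul_mat]; exact ev_fromBlocks _ _ u v

lemma bl_pm_succ {A : Type} [CommRing A] (X : ℕ → A) (D : A) (n : ℕ) (u v u' v' : PI n → A) :
    bl (ι := PI (n+1)) (pm X D (n+1)) (Sum.elim u v) (Sum.elim u' v')
      = bl (pm X D n) u u' + X n * bl (pm X D n) v v' := by
  show bl (ι := PI n ⊕ PI n) (fromBlocks _ 0 0 (X n • _)) _ _ = _
  rw [← bl_smul_mat]; exact bl_fromBlocks _ _ u u' v v'

lemma elim_surj {α β A : Type} (w : α ⊕ β → A) : ∃ u v, w = Sum.elim u v :=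
  ⟨_, _, (Sum.elim_comp_inl_inr w).symm⟩

/-- nondegenerate polar form -/
def Nd {ι : Type} [Fintype ι] {A : Type} [CommRing A] (q : Matrix ι ι A) : Prop :=
  ∀ x, (∀ y, bl q x y = 0) → x = 0

section field
variable {K : Type} [Field K]

lemma nd_pm (h2 : (2 : K) = 0) (X : ℕ → K) (D : K) (n : ℕ) (hX : ∀ i < n, X i ≠ 0) : Nd (pm X D n) := by
  induction n with
  | zero =>
    intro x hx
    have h0 := (bl_pm_zero X D x (![1, 0] : Fin 2 → K)).symm.trans (hx (![1, 0] : Fin 2 → K))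
    have h1 := (bl_pm_zero X D x (![0, 1] : Fin 2 → K)).symm.trans (hx (![0, 1] : Fin 2 → K))
    simp [h2] at h0 h1
    funext i
    have : ∀ i : Fin 2, x i = 0 := by intro i; fin_cases i; exacts [h1, h0]
    exact this i
  | succ n ih =>
    intro x hx
    obtain ⟨u, v, rfl⟩ := elim_surj x
    have hu : u = 0 := ih (fun i hi => hX i (by omega)) u (fun y => by
      have := hx (Sum.elim y 0)
      rwa [bl_pm_succ, bl_zero_right, mul_zero, add_zero] at this)
    have hv : v = 0 := ih (fun i hi => hX i (by omega)) v (fun y => by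
      have := hx (Sum.elim 0 y)
      rw [bl_pm_succ, bl_zero_right, zero_add] at this
      exact (mul_eq_zero.1 this).resolve_left (hX n (by omega)))
    rw [hu, hv]; funext i; rcases i with i | i <;> rfl

/-- similarity factors -/
def Sim {ι : Type} [Fintype ι] {K : Type} [Field K] (q : Matrix ι ι K) (a : K) : Prop :=
  ∃ S : (ι → K) →ₗ[K] (ι → K), ∀ w, ev q (S w) = a * ev q w

lemma sim_bl {ι : Type} [Fintype ι] (q : Matrix ι ι K) (a : K) (S : (ι → K) →ₗ[K] (ι → K))
    (hS : ∀ w, ev q (S w) = a * ev q w) (v w : ι → K) : bl q (S v) (S w) = a * bl q v w := by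
  have h := hS (v + w)
  rw [map_add, ev_add, ev_add, hS, hS] at h
  linear_combination h

lemma sim_inv {ι : Type} [Fintype ι] (q : Matrix ι ι K) (hq : Nd q) (a : K) (ha : a ≠ 0)
    (S : (ι → K) →ₗ[K] (ι → K))
    (hS : ∀ w, ev q (S w) = a * ev q w) :
    ∃ S' : (ι → K) →ₗ[K] (ι → K), (∀ w, S (S' w) = w) := by
  have hinj : Function.Injective S := by
    rw [← LinearMap.ker_eq_bot, LinearMap.ker_eq_bot']
    intro x hx
    refine hq x fun y => ?_
    have := sim_bl q a S hS x y
    rw [hx, bl_zero_left] at this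
    exact (mul_eq_zero.1 this.symm).resolve_left ha
  let e := LinearEquiv.ofInjectiveEndo S hinj
  exact ⟨e.symm, fun w => e.apply_symm_apply w⟩

/-- combine two linear maps into a linear map on the sum type -/
def elimL {α β V : Type} [AddCommGroup V] [Module K V] (f : V →ₗ[K] (α → K)) (g : V →ₗ[K] (β → K)) :
    V →ₗ[K] (α ⊕ β → K) where
  toFun v := Sum.elim (f v) (g v)
  map_add' x y := by funext i; rcases i with i | i <;> simp
  map_smul' x y := by funext i; rcases i with i | i <;> simp

lemma elimL_apply {α β V : Type} [AddCommGroup V] [Module K V] (f : V →ₗ[K] (α → K))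
    (g : V →ₗ[K] (β → K)) (v : V) : elimL f g v = Sum.elim (f v) (g v) := rfl

/-- left projection -/
def pl {α β : Type} : (α ⊕ β → K) →ₗ[K] (α → K) := LinearMap.funLeft K K Sum.inl
/-- right projection -/
def pr {α β : Type} : (α ⊕ β → K) →ₗ[K] (β → K) := LinearMap.funLeft K K Sum.inr
lemma pl_elim {α β : Type} (u : α → K) (v : β → K) : pl (Sum.elim u v) = u := rfl
lemma pr_elim {α β : Type} (u : α → K) (v : β → K) : pr (Sum.elim u v) = v := rfl

lemma sim_base (h2 : (2 : K) = 0) (D : K) (u : Fin 2 → K) : Sim (!![1, 1; 0, D] : Matrix (Fin 2) (Fin 2) K)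
    (ev (!![1, 1; 0, D] : Matrix (Fin 2) (Fin 2) K) u) := by
  have hlin : ∃ S : (Fin 2 → K) →ₗ[K] (Fin 2 → K), ∀ w, S w =
      ![u 0 * w 0 + D * u 1 * w 1, u 0 * w 1 + u 1 * w 0 + u 1 * w 1] := by
    refine ⟨⟨⟨fun w => ![u 0 * w 0 + D * u 1 * w 1, u 0 * w 1 + u 1 * w 0 + u 1 * w 1], ?_⟩, ?_⟩,
      fun w => rfl⟩
    · intro x y; funext i; fin_cases i <;> simp <;> ring
    · intro a x; funext i; fin_cases i <;> simp <;> ring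
  have hev : ∀ w : Fin 2 → K, ev (!![1, 1; 0, D] : Matrix (Fin 2) (Fin 2) K) w =
      w 0 ^ 2 + w 0 * w 1 + D * w 1 ^ 2 := fun w => ev_pm_zero (fun _ => 0) D w
  obtain ⟨S, hS⟩ := hlin
  refine ⟨S, fun w => ?_⟩
  rw [hev, hev, hev, hS]
  simp
  linear_combination (u 0 * w 0 * D * u 1 * w 1 + D * u 1 ^ 2 * w 1 ^ 2 + D * (u 0 * w 1 * u 1 * w 0 +
      u 0 * w 1 * u 1 * w 1 + u 1 * w 0 * u 1 * w 1)) * h2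

lemma sim_pm (h2 : (2 : K) = 0) (X : ℕ → K) (D : K) (n : ℕ) (hX : ∀ i < n, X i ≠ 0) (u : PI n → K)
    (hu : ev (pm X D n) u ≠ 0) : Sim (pm X D n) (ev (pm X D n) u) := by
  induction n with
  | zero =>
    exact sim_base h2 D u
  | succ n ih =>
    obtain ⟨u1, u2, rfl⟩ := elim_surj u
    rw [ev_pm_succ] at hu ⊢
    have ih := ih (fun i hi => hX i (by omega))
    have hnd := nd_pm h2 X D n (fun i hi => hX i (by omega))
    have key : ∀ (f g : (PI n ⊕ PI n → K) →ₗ[K] (PI n → K)) (c : K),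
        (∀ w1 w2, ev (pm X D n) (f (Sum.elim w1 w2)) + X n * ev (pm X D n) (g (Sum.elim w1 w2))
          = c * (ev (pm X D n) w1 + X n * ev (pm X D n) w2)) → Sim (pm X D (n+1)) c := by
      intro f g c h
      refine ⟨elimL f g, fun w => ?_⟩
      obtain ⟨w1, w2, rfl⟩ := elim_surj w
      rw [ev_pm_succ, ← h w1 w2]
      exact ev_pm_succ X D n _ _
    by_cases ha : ev (pm X D n) u1 = 0
    · have hb : ev (pm X D n) u2 ≠ 0 := by rintro hb; simp [ha, hb] at hu
      obtain ⟨T, hT⟩ := ih u2 hb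
      refine key (X n • (T ∘ₗ pr)) (T ∘ₗ pl) _ fun w1 w2 => ?_
      simp only [LinearMap.smul_apply, LinearMap.comp_apply, pl_elim, pr_elim, ev_smul, hT, ha]
      ring
    · obtain ⟨S, hS⟩ := ih u1 ha
      by_cases hb : ev (pm X D n) u2 = 0
      · refine key (S ∘ₗ pl) (S ∘ₗ pr) _ fun w1 w2 => ?_
        simp only [LinearMap.smul_apply, LinearMap.comp_apply, pl_elim, pr_elim, ev_smul, hS, hb]
        ring
      · obtain ⟨T, hT⟩ := ih u2 hb
        obtain ⟨S', hS'⟩ := sim_inv _ hnd _ ha S hS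
        set a := ev (pm X D n) u1
        set b := ev (pm X D n) u2
        refine key (S ∘ₗ pl + X n • (T ∘ₗ pr)) (T ∘ₗ pl + (a / b) • (T ∘ₗ S' ∘ₗ T ∘ₗ pr)) _
          fun w1 w2 => ?_
        simp only [LinearMap.smul_apply, LinearMap.comp_apply, LinearMap.add_apply, pl_elim,
          pr_elim, ev_smul, ev_add, hS, hT, bl_smul_right]
        have e1 : a * ev (pm X D n) (S' (T w2)) = b * ev (pm X D n) w2 := by
          rw [← hS, hS', hT]
        have e2 : bl (pm X D n) (T w1) (T (S' (T w2))) = b * bl (pm X D n) w1 (S' (T w2)) :=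
          sim_bl _ b T hT _ _
        have e3 : bl (pm X D n) (S w1) (T w2) = a * bl (pm X D n) w1 (S' (T w2)) := by
          rw [← sim_bl _ a S hS, hS']
        rw [e2, e3]
        field_simp
        have e1' : a ^ 2 * ev (pm X D n) (S' (T w2)) = a * (b * ev (pm X D n) w2) := by
          rw [← e1]; ring
        linear_combination (X n) * e1' + (b * X n * a * bl (pm X D n) w1 (S' (T w2))) * h2

lemma mul_closed (h2 : (2 : K) = 0) (X : ℕ → K) (D : K) (n : ℕ) (hX : ∀ i < n, X i ≠ 0) (u v : PI n → K) :
    ∃ w, ev (pm X D n) w = ev (pm X D n) u * ev (pm X D n) v := by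
  by_cases hu : ev (pm X D n) u = 0
  · exact ⟨0, by rw [hu, ev_zero, zero_mul]⟩
  · obtain ⟨S, hS⟩ := sim_pm h2 X D n hX u hu
    exact ⟨S v, hS v⟩

lemma tot_iso (h2 : (2 : K) = 0) (X : ℕ → K) (D : K) (n : ℕ) (hX : ∀ i < n, X i ≠ 0) (h : ¬ An (pm X D n)) :
    ∃ I : Submodule K (PI n → K), Module.finrank K I = 2 ^ n ∧ ∀ x ∈ I, ev (pm X D n) x = 0 := by
  induction n with
  | zero =>
    obtain ⟨x, hx, hx0⟩ := an_iff_of_iso_not.1 h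
    refine ⟨K ∙ x, finrank_span_singleton hx, ?_⟩
    intro y hy
    obtain ⟨a, rfl⟩ := Submodule.mem_span_singleton.1 hy
    rw [ev_smul, hx0, mul_zero]
  | succ n ih =>
    have hX' : ∀ i < n, X i ≠ 0 := fun i hi => hX i (by omega)
    have hr : ∀ (V : Type) [AddCommGroup V] [Module K V] [FiniteDimensional K V]
      (f g : V →ₗ[K] (PI n → K)), Module.finrank K V = 2 ^ (n+1) →
      (∀ v, f v = 0 → g v = 0 → v = 0) →
      (∀ v, ev (pm X D n) (f v) + X n * ev (pm X D n) (g v) = 0) →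
      ∃ I : Submodule K (PI (n+1) → K), Module.finrank K I = 2 ^ (n+1) ∧
        ∀ x ∈ I, ev (pm X D (n+1)) x = 0 := by
      intro V _ _ _ f g hV hi h0
      refine ⟨LinearMap.range (elimL f g), ?_, ?_⟩
      · rw [← hV]
        refine LinearMap.finrank_range_of_inj ?_
        refine (injective_iff_map_eq_zero _).2 ?_
        intro v hv
        refine hi v ?_ ?_
        · funext i; exact congrFun hv (Sum.inl i)
        · funext i; exact congrFun hv (Sum.inr i)
      · rintro _ ⟨v, rfl⟩
        exact (ev_pm_succ X D n _ _).trans (h0 v)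
    by_cases h1 : An (pm X D n)
    · obtain ⟨x, hx, hx0⟩ := an_iff_of_iso_not.1 h
      obtain ⟨u, v, rfl⟩ := elim_surj x
      rw [ev_pm_succ] at hx0
      have hv : ev (pm X D n) v ≠ 0 := by
        intro hv
        rw [hv, mul_zero, add_zero] at hx0
        apply hx
        rw [h1 _ hv, h1 _ hx0]; funext i; rcases i with i | i <;> rfl
      obtain ⟨T, hT⟩ := sim_pm h2 X D n hX' v hv
      obtain ⟨w, hw⟩ := mul_closed h2 X D n hX' u v
      have hw' : ev (pm X D n) ((ev (pm X D n) v)⁻¹ • w) = X n := by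
        rw [ev_smul, hw]
        field_simp
        linear_combination hx0 - X n * ev (pm X D n) v * h2
      obtain ⟨σ, hσ⟩ := sim_pm h2 X D n hX' _ (hw'.trans_ne (hX n (by omega)))
      refine hr (PI n → K) σ LinearMap.id ?_ (fun v _ h => h) ?_
      · rw [Module.finrank_pi, card_PI]
      · intro v
        rw [hσ, hw', LinearMap.id_apply]
        linear_combination X n * ev (pm X D n) v * h2
    · obtain ⟨I, hI, hI0⟩ := ih hX' h1
      refine hr (I × I) (I.subtype ∘ₗ LinearMap.fst K I I) (I.subtype ∘ₗ LinearMap.snd K I I) ?_ ?_ ?_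
      · rw [Module.finrank_prod, hI]; ring
      · rintro ⟨a, b⟩ h1 h2
        simp at h1 h2; simp [h1, h2]
      · rintro ⟨a, b⟩
        simp [hI0]

end field
end HS

namespace HS
open Matrix
open Polynomial

section CP
variable {K : Type} [Field K] {κ μ : Type} [Fintype κ]

lemma ev_eq_sum {A : Type} [CommRing A] (q : Matrix κ κ A) (x : κ → A) :
    ev q x = ∑ i, ∑ j, q i j * (x i * x j) := by
  simp only [ev, dotProduct, mulVec, Finset.mul_sum]
  refine Finset.sum_congr rfl fun i _ => Finset.sum_congr rfl fun j _ => by ring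

lemma natDegree_ev_le (q : Matrix κ κ K) (p : κ → K[X]) (e : ℕ) (h : ∀ i, (p i).natDegree ≤ e) :
    (ev (q.map C) p).natDegree ≤ e + e := by
  rw [ev_eq_sum]
  refine natDegree_sum_le_of_forall_le _ _ fun i _ => natDegree_sum_le_of_forall_le _ _ fun j _ => ?_
  simp only [map_apply]
  refine (natDegree_C_mul_le _ _).trans ?_
  exact natDegree_mul_le_of_le (h i) (h j)

lemma coeff_ev (q : Matrix κ κ K) (p : κ → K[X]) (e : ℕ) (h : ∀ i, (p i).natDegree ≤ e) :
    (ev (q.map C) p).coeff (e + e) = ev q (fun i => (p i).coeff e) := by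
  rw [ev_eq_sum, ev_eq_sum, finset_sum_coeff]
  refine Finset.sum_congr rfl fun i _ => ?_
  rw [finset_sum_coeff]
  refine Finset.sum_congr rfl fun j _ => ?_
  simp only [map_apply, coeff_C_mul]
  rw [coeff_mul_add_eq_of_natDegree_le (h i) (h j)]

lemma bl_eq_sum {A : Type} [CommRing A] (q : Matrix κ κ A) (x y : κ → A) :
    bl q x y = ∑ i, ∑ j, q i j * (x i * y j + y i * x j) := by
  simp only [bl, dotProduct, mulVec, Finset.mul_sum]
  rw [← Finset.sum_add_distrib]
  refine Finset.sum_congr rfl fun i _ => ?_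
  rw [← Finset.sum_add_distrib]
  refine Finset.sum_congr rfl fun j _ => by ring

lemma natDegree_bl_le (q : Matrix κ κ K) (u : κ → K) (p : κ → K[X]) (e : ℕ)
    (h : ∀ i, (p i).natDegree ≤ e) :
    (bl (q.map C) (fun i => C (u i)) p).natDegree ≤ e := by
  rw [bl_eq_sum]
  refine natDegree_sum_le_of_forall_le _ _ fun i _ => natDegree_sum_le_of_forall_le _ _ fun j _ => ?_
  simp only [map_apply]
  refine (natDegree_C_mul_le _ _).trans ?_
  refine natDegree_add_le_of_degree_le ((natDegree_C_mul_le _ _).trans (h _))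
    ((natDegree_mul_C_le _ _).trans (h _))

lemma deg_drop (q : Matrix κ κ K) (hq : An q) (p : κ → K[X]) (e : ℕ)
    (h : (ev (q.map C) p).natDegree ≤ e + e) : ∀ i, (p i).natDegree ≤ e := by
  have key : ∀ k, (∀ i, (p i).natDegree ≤ e + k) → ∀ i, (p i).natDegree ≤ e := by
    intro k
    induction k with
    | zero => intro h; exact h
    | succ k ih =>
      intro hk
      apply ih
      have h1 := coeff_ev q p _ hk
      rw [coeff_eq_zero_of_natDegree_lt (by omega)] at h1
      have h3 := hq _ h1.symm
      intro i
      have h4 := congrFun h3 i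
      have h5 := hk i
      simp only [Pi.zero_apply] at h4
      by_contra hlt
      have h6 : (p i).natDegree = e + (k+1) := by omega
      rw [← h6] at h4
      have h7 := leadingCoeff_eq_zero.1 h4
      rw [h7] at h6
      simp at h6
  refine key (∑ i, (p i).natDegree) fun i => ?_
  have := Finset.single_le_sum (f := fun i => (p i).natDegree) (fun _ _ => Nat.zero_le _) (Finset.mem_univ i)
  exact this.trans (by omega)

lemma rel_cp (h2 : (2 : K) = 0) (π : Matrix κ κ K) (hπ : An π) (U : μ → κ → K) (f : K[X])
    (l : μ → K[X]) (δ : ℕ) : ∀ (d : K[X]) (hd : d ≠ 0) (hδ : d.natDegree ≤ δ) (P : κ → K[X])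
    (hP : ev (π.map C) P = d ^ 2 * f)
    (hU : ∀ i, bl (π.map C) (fun j => C (U i j)) P = d * l i),
    ∃ p : κ → K[X], ev (π.map C) p = f ∧ ∀ i, bl (π.map C) (fun j => C (U i j)) p = l i := by
  have h2' : (2 : K[X]) = 0 := by
    have := congrArg (C : K → K[X]) h2; rwa [map_zero, map_ofNat] at this
  have const : ∀ (d : K[X]) (hd : d ≠ 0) (w : κ → K[X])
    (hP : ev (π.map C) (d • w) = d ^ 2 * f)
    (hU : ∀ i, bl (π.map C) (fun j => C (U i j)) (d • w) = d * l i),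
    ∃ p : κ → K[X], ev (π.map C) p = f ∧ ∀ i, bl (π.map C) (fun j => C (U i j)) p = l i := by
    intro d hd w hP hU
    refine ⟨w, ?_, fun i => ?_⟩
    · rw [ev_smul] at hP
      exact mul_left_cancel₀ (pow_ne_zero 2 hd) hP
    · have := hU i
      rw [bl_smul_right] at this
      exact mul_left_cancel₀ hd this
  have decomp : ∀ (d : K[X]) (P : κ → K[X]), P = d • (fun i => P i / d) + fun i => P i % d := by
    intro d P; funext i; simp [EuclideanDomain.div_add_mod]
  induction δ with
  | zero =>
    intro d hd hδ P hP hU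
    have h0 : (fun i => P i % d) = 0 := by
      funext i
      have : IsUnit d := by
        rw [isUnit_iff_degree_eq_zero, degree_eq_natDegree hd]; simpa using hδ
      exact EuclideanDomain.mod_eq_zero.2 this.dvd
    have h1 := decomp d P
    rw [h0, add_zero] at h1
    rw [h1] at hP hU
    exact const d hd _ hP hU
  | succ δ ih =>
    intro d hd hδ P hP hU
    by_cases hlt : d.natDegree ≤ δ
    · exact ih d hd hlt P hP hU
    have hdeg : d.natDegree = δ + 1 := by omega
    set w : κ → K[X] := fun i => P i / d with hw
    set R : κ → K[X] := fun i => P i % d with hR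
    have hdec : P = d • w + R := decomp d P
    by_cases hR0 : R = 0
    · rw [hR0, add_zero] at hdec
      rw [hdec] at hP hU
      exact const d hd _ hP hU
    have hRdeg : ∀ i, (R i).natDegree ≤ δ := by
      intro i
      have := natDegree_mod_lt (P i) (q := d) (by omega)
      show (P i % d).natDegree ≤ δ
      omega
    have hevR : ev (π.map C) R ≠ 0 := fun h => hR0 (an_poly π hπ R h)
    set b := bl (π.map C) P w with hb
    set d' := d * (f + ev (π.map C) w) + b with hd'
    have hdd : d * d' = ev (π.map C) R := by
      have e1 : R = P + d • w := by
        rw [hdec]; funext i; simp; linear_combination (- (d * w i)) * h2'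
      rw [e1, ev_add, hP, ev_smul, bl_smul_right, hd']
      ring
    have hd0 : d' ≠ 0 := by rintro h; rw [h, mul_zero] at hdd; exact hevR hdd.symm
    have hdeg' : d'.natDegree ≤ δ := by
      have h1 := natDegree_ev_le π R δ hRdeg
      rw [← hdd, natDegree_mul hd hd0] at h1
      omega
    have hUw : ∀ i, bl (π.map C) (fun j => C (U i j)) w = l i := by
      intro i
      have h1 := hU i
      rw [hdec, bl_add_right, bl_smul_right] at h1
      have h3 := natDegree_bl_le π (U i) R δ hRdeg
      have h4 : d ∣ bl (π.map C) (fun j => C (U i j)) R :=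
        ⟨l i - bl (π.map C) (fun j => C (U i j)) w, by linear_combination h1⟩
      have h5 := eq_zero_of_dvd_of_natDegree_lt h4 (by omega)
      rw [h5, add_zero] at h1
      exact mul_left_cancel₀ hd h1
    refine ih d' hd0 hdeg' ((f + ev (π.map C) w) • P + b • w) ?_ ?_
    · rw [ev_add, ev_smul, ev_smul, bl_smul_left, bl_smul_right, hP, ← hb, hd']
      linear_combination (b ^ 2 * ev (π.map C) w - d * (f + ev (π.map C) w) * b * f) * h2'
    · intro i
      rw [bl_add_right, bl_smul_right, bl_smul_right, hU, hUw, hd']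
      ring

/-- rational function field -/
abbrev RF (K : Type) [Field K] := FractionRing K[X]
/-- embedding of constants -/
noncomputable abbrev iF (K : Type) [Field K] : K →+* RF K := (algebraMap K[X] (RF K)).comp C

lemma an_RF (q : Matrix κ κ K) (h : An q) : An (q.map (iF K)) := by
  have := an_frac (L := RF K) _ (an_poly q h)
  rwa [Matrix.map_map] at this

lemma cp_lin (h2 : (2 : K) = 0) (π : Matrix κ κ K) (hπ : An π) (U : μ → κ → K) (a b c : K)
    (l0 l1 : μ → K) (p : κ → RF K)
    (hp : ev (π.map (iF K)) p = algebraMap K[X] (RF K) (C a + C b * X + C c * X ^ 2))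
    (hU : ∀ i, bl (π.map (iF K)) (fun j => iF K (U i j)) p =
      algebraMap K[X] (RF K) (C (l0 i) + C (l1 i) * X)) :
    ∃ p0 p1 : κ → K, ev π p0 = a ∧ bl π p0 p1 = b ∧ ev π p1 = c ∧
      ∀ i, bl π (U i) p0 = l0 i ∧ bl π (U i) p1 = l1 i := by
  have hinj := IsFractionRing.injective K[X] (RF K)
  obtain ⟨d, hd⟩ := IsLocalization.exist_integer_multiples_of_finite (nonZeroDivisors K[X]) p
  choose P hPd using hd
  have hmm : π.map (iF K) = (π.map C).map (algebraMap K[X] (RF K)) := by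
    rw [Matrix.map_map]; rfl
  have h1 : (fun i => algebraMap K[X] (RF K) (P i)) = (algebraMap K[X] (RF K) d) • p := by
    funext i; rw [hPd i]; simp [Algebra.smul_def, Submonoid.smul_def]
  obtain ⟨P', hP', hU'⟩ := rel_cp h2 π hπ U (C a + C b * X + C c * X ^ 2)
    (fun i => C (l0 i) + C (l1 i) * X) _ d (nonZeroDivisors.ne_zero d.2) le_rfl P (by
      apply hinj
      rw [← ev_map, ← hmm, h1, ev_smul, hp, map_mul, map_pow]) (by
      intro i
      apply hinj
      rw [← bl_map, ← hmm, h1, bl_smul_right]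
      have := hU i
      simp only [iF, RingHom.comp_apply] at this
      rw [map_mul, ← this])
  have hdeg : ∀ i, (P' i).natDegree ≤ 1 := by
    refine deg_drop π hπ P' 1 ?_
    rw [hP']; compute_degree
  set p0 : κ → K := fun i => (P' i).coeff 0
  set p1 : κ → K := fun i => (P' i).coeff 1
  have hPe : P' = (fun i => C (p0 i)) + (X : K[X]) • (fun i => C (p1 i)) := by
    funext i
    have := eq_X_add_C_of_natDegree_le_one (hdeg i)
    simp only [Pi.add_apply, Pi.smul_apply, smul_eq_mul]
    rw [this]; simp [p0, p1]; ring
  rw [hPe, ev_add, ev_smul, bl_smul_right, ev_map, ev_map, bl_map] at hP'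
  have c0 := congrArg (fun q => coeff q 0) hP'
  have c1 := congrArg (fun q => coeff q 1) hP'
  have c2 := congrArg (fun q => coeff q 2) hP'
  simp [coeff_X, coeff_C, coeff_X_pow, coeff_mul_C] at c0 c1 c2
  refine ⟨p0, p1, c0, c1, c2, fun i => ?_⟩
  have h3 := hU' i
  rw [hPe, bl_add_right, bl_smul_right, bl_map, bl_map] at h3
  have c0 := congrArg (fun q => coeff q 0) h3
  have c1 := congrArg (fun q => coeff q 1) h3
  simp [coeff_X, coeff_C, coeff_X_pow, coeff_mul_C] at c0 c1
  exact ⟨c0, c1⟩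

end CP
end HS

namespace HS
open Matrix
open Polynomial

section Dom
variable {E : Type} [Field E] {κ ν : Type} [Fintype κ] [Fintype ν]

lemma two_map {K L : Type} [Field K] [Field L] (f : K →+* L) (h : (2 : K) = 0) : (2 : L) = 0 := by
  have := congrArg f h; rwa [map_zero, map_ofNat] at this

lemma dom_aux (h2 : (2 : E) = 0) (π : Matrix κ κ E) (hπ : An π) (γ : Matrix ν ν E) (e : ℕ → ν → E)
    (H : ∀ (K : Type) [Field K] (f : E →+* K), An (π.map f) → ∀ x : ν → K,
      ∃ p, ev (π.map f) p = ev (γ.map f) x) (k : ℕ) :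
    ∃ U : ℕ → κ → E, (∀ i < k, ev π (U i) = ev γ (e i)) ∧
      (∀ i < k, ∀ j < k, bl π (U i) (U j) = bl γ (e i) (e j)) ∧
      ∀ (K : Type) [Field K] (f : E →+* K), An (π.map f) → ∀ x : ν → K,
      ∃ p, ev (π.map f) p = ev (γ.map f) x ∧
        ∀ i < k, bl (π.map f) (fun j => f (U i j)) p = bl (γ.map f) (fun j => f (e i j)) x := by
  induction k with
  | zero =>
    refine ⟨fun _ => 0, by simp, by simp, fun K _ f hf x => ?_⟩
    obtain ⟨p, hp⟩ := H K f hf x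
    exact ⟨p, hp, by simp⟩
  | succ k ih =>
    obtain ⟨U, hU1, hU2, hU3⟩ := ih
    have hid : π.map (RingHom.id E) = π := by ext; simp
    have hid' : γ.map (RingHom.id E) = γ := by ext; simp
    obtain ⟨u, hu1, hu2⟩ := hU3 E (RingHom.id E) (by rwa [hid]) (e k)
    rw [hid, hid'] at hu1 hu2
    simp only [RingHom.id_apply] at hu1 hu2
    have hup : ∀ i < k, Function.update U k u i = U i := fun i hi =>
      Function.update_of_ne (by omega) _ _
    have hupk : Function.update U k u k = u := Function.update_self ..
    refine ⟨Function.update U k u, ?_, ?_, ?_⟩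
    · intro i hi
      rcases Nat.lt_succ_iff_lt_or_eq.1 hi with h | rfl
      · rw [hup i h, hU1 i h]
      · rw [hupk, hu1]
    · intro i hi j hj
      rcases Nat.lt_succ_iff_lt_or_eq.1 hi with h | rfl <;>
      rcases Nat.lt_succ_iff_lt_or_eq.1 hj with h' | rfl
      · rw [hup i h, hup j h', hU2 i h j h']
      · rw [hup i h, hupk, hu2 i h]
      · rw [hup j h', hupk, bl_comm, hu2 j h', bl_comm]
      · rw [hupk, bl_self, bl_self, h2, zero_mul, zero_mul]
    · intro K _ f hf x
      have h2K : (2 : K) = 0 := two_map f h2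
      have hmm : π.map ((iF K).comp f) = (π.map f).map (iF K) := by rw [Matrix.map_map]; rfl
      have hmm' : γ.map ((iF K).comp f) = (γ.map f).map (iF K) := by rw [Matrix.map_map]; rfl
      set t : RF K := algebraMap K[X] (RF K) X
      have hiC : ∀ a : K, iF K a = algebraMap K[X] (RF K) (C a) := fun a => rfl
      obtain ⟨p, hp1, hp2⟩ := hU3 (RF K) ((iF K).comp f) (by rw [hmm]; exact an_RF _ hf)
        ((fun j => iF K (x j)) + t • (fun j => iF K (f (e k j))))
      rw [hmm, hmm', ev_add, ev_smul, bl_smul_right, ev_map, ev_map, bl_map] at hp1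
      rw [hmm, hmm'] at hp2
      obtain ⟨p0, p1, q1, q2, q3, q4⟩ := cp_lin (μ := {i : ℕ // i < k}) h2K (π.map f) hf
        (fun i j => f (U i j))
        (ev (γ.map f) x) (bl (γ.map f) x (fun j => f (e k j))) (ev (γ.map f) (fun j => f (e k j)))
        (fun i => bl (γ.map f) (fun j => f (e i j)) x)
        (fun i => bl (γ.map f) (fun j => f (e i j)) (fun j => f (e k j))) p (by
          rw [hp1]; simp only [hiC, t, map_add, map_mul, map_pow]; ring) (by
          intro i
          have := hp2 i i.2
          rw [bl_add_right, bl_smul_right] at this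
          simp only [RingHom.comp_apply] at this
          have e1 := bl_map (iF K) (γ.map f) (fun j => f (e i j)) x
          have e2 := bl_map (iF K) (γ.map f) (fun j => f (e i j)) (fun j => f (e k j))
          simp only [RingHom.comp_apply] at e1 e2
          rw [e1, e2] at this
          simp only [RingHom.comp_apply]
          rw [this]; simp only [t, map_add, map_mul]; ring)
      set uf : κ → K := fun j => f (u j) with huf
      have huf1 : ev (π.map f) uf = ev (γ.map f) (fun j => f (e k j)) := by
        rw [huf, ev_map, ev_map, hu1]
      have huf2 : ∀ i < k, bl (π.map f) (fun j => f (U i j)) uf =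
          bl (γ.map f) (fun j => f (e i j)) (fun j => f (e k j)) := by
        intro i hi
        rw [huf, bl_map, bl_map, hu2 i hi]
      have fin : ∀ p, ev (π.map f) p = ev (γ.map f) x →
          (∀ i < k, bl (π.map f) (fun j => f (U i j)) p = bl (γ.map f) (fun j => f (e i j)) x) →
          bl (π.map f) uf p = bl (γ.map f) (fun j => f (e k j)) x →
          ∃ p, ev (π.map f) p = ev (γ.map f) x ∧
          ∀ i < k + 1, bl (π.map f) (fun j => f (Function.update U k u i j)) p =
            bl (γ.map f) (fun j => f (e i j)) x := by
        intro p a1 a2 a3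
        refine ⟨p, a1, fun i hi => ?_⟩
        rcases Nat.lt_succ_iff_lt_or_eq.1 hi with h | rfl
        · rw [hup i h, a2 i h]
        · rw [hupk]; exact a3
      by_cases hy : p1 + uf = 0
      · have : p1 = uf := by
          funext i
          have := congrFun hy i
          simp only [Pi.add_apply, Pi.zero_apply] at this
          linear_combination this - uf i * h2K
        refine fin p0 q1 (fun i hi => (q4 ⟨i, hi⟩).1) ?_
        rw [← this, bl_comm, q2, bl_comm]
      · set y := p1 + uf with hydef
        have hey : ev (π.map f) y ≠ 0 := fun h => hy (hf _ h)
        have hey' : ev (π.map f) y = bl (π.map f) uf p1 := by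
          rw [hydef, ev_add, q3, huf1, bl_comm]
          linear_combination (ev (γ.map f) (fun j => f (e k j))) * h2K
        refine fin (p0 + (bl (π.map f) p0 y / ev (π.map f) y) • y) ?_ ?_ ?_
        · rw [ev_add, ev_smul, bl_smul_right, q1]
          field_simp
          linear_combination (bl (π.map f) p0 y) ^ 2 * h2K
        · intro i hi
          rw [bl_add_right, bl_smul_right, (q4 ⟨i, hi⟩).1, hydef, bl_add_right _ (fun j => f (U i j)),
            (q4 ⟨i, hi⟩).2, huf2 i hi]
          linear_combination (bl (π.map f) p0 (p1 + uf) / ev (π.map f) (p1 + uf) *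
            bl (γ.map f) (fun j => f (e i j)) (fun j => f (e k j))) * h2K
        · have e1 : bl (π.map f) uf y = ev (π.map f) y := by
            rw [hey', hydef, bl_add_right, bl_self, h2K]; ring
          rw [bl_add_right, bl_smul_right, e1, div_mul_cancel₀ _ hey, hydef, bl_add_right, q2,
            bl_comm _ uf p0, bl_comm _ x]
          linear_combination (bl (π.map f) p0 uf) * h2K

lemma gram_ev {A : Type} [CommRing A] {τ : Type} (q : Matrix κ κ A) (q' : Matrix ν ν A)
    (u : τ → κ → A) (v : τ → ν → A) (c : A)
    (s : Finset τ) (x : τ → A) (h1 : ∀ i ∈ s, ev q (u i) = c * ev q' (v i))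
    (h2 : ∀ i ∈ s, ∀ j ∈ s, bl q (u i) (u j) = c * bl q' (v i) (v j)) :
    ev q (∑ i ∈ s, x i • u i) = c * ev q' (∑ i ∈ s, x i • v i) := by
  classical
  induction s using Finset.induction_on with
  | empty => simp [ev_zero]
  | insert a s ha ih =>
    rw [Finset.sum_insert ha, Finset.sum_insert ha, ev_add, ev_add, ev_smul, ev_smul,
      ih (fun i hi => h1 i (Finset.mem_insert_of_mem hi))
      (fun i hi j hj => h2 i (Finset.mem_insert_of_mem hi) j (Finset.mem_insert_of_mem hj)),
      h1 a (Finset.mem_insert_self _ _), bl_smul_left, bl_smul_left]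
    have : bl q (u a) (∑ i ∈ s, x i • u i) = c * bl q' (v a) (∑ i ∈ s, x i • v i) := by
      simp only [← blm_apply, map_sum, map_smul, smul_eq_mul, Finset.mul_sum]
      refine Finset.sum_congr rfl fun i hi => ?_
      rw [blm_apply, blm_apply, h2 a (Finset.mem_insert_self _ _) i (Finset.mem_insert_of_mem hi)]
      ring
    rw [this]; ring

/-- Domination theorem, for the form `c γ` on `Fin N`. -/
lemma dom {N : ℕ} (h2 : (2 : E) = 0) (π : Matrix κ κ E) (hπ : An π)
    (γ : Matrix (Fin N) (Fin N) E) (c : E)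
    (H : ∀ (K : Type) [Field K] (f : E →+* K), An (π.map f) → ∀ x : Fin N → K,
      ∃ p, ev (π.map f) p = f c * ev (γ.map f) x) :
    ∃ U : Fin N → κ → E, ∀ (K : Type) [Field K] (f : E →+* K) (x : Fin N → K),
      ev (π.map f) (∑ i, x i • fun j => f (U i j)) = f c * ev (γ.map f) x := by
  classical
  let e : ℕ → Fin N → E := fun k => if h : k < N then Pi.single ⟨k, h⟩ 1 else 0
  have hcm : ∀ (K : Type) [Field K] (f : E →+* K), (c • γ).map f = f c • γ.map f := by
    intro K _ f; ext; simp
  obtain ⟨U, hU1, hU2, -⟩ := dom_aux h2 π hπ (c • γ) e (by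
    intro K _ f hf x
    obtain ⟨p, hp⟩ := H K f hf x
    refine ⟨p, ?_⟩
    rw [hcm, ev_smul_mat, hp]) N
  refine ⟨fun i => U i, fun K _ f x => ?_⟩
  have he : ∀ i : Fin N, (fun j => f (e i j)) = (Pi.single i 1 : Fin N → K) := by
    intro i; funext j
    simp only [e, i.2, dif_pos, Fin.eta]
    by_cases h : j = i
    · subst h; simp
    · simp [Pi.single_eq_of_ne h]
  have := gram_ev (π.map f) (γ.map f) (fun (i : Fin N) j => f (U i j))
    (fun i => (Pi.single i 1 : Fin N → K)) (f c) Finset.univ x (by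
      intro i _
      rw [← he, ev_map, ev_map, hU1 i i.2, ev_smul_mat, map_mul]) (by
      intro i _ j _
      rw [← he, ← he, bl_map, bl_map, hU2 i i.2 j j.2, bl_smul_mat, map_mul])
  rw [this]
  congr 2
  funext j
  simp [Finset.sum_apply, Pi.single_apply]

end Dom

section L6
variable {E : Type} [Field E] {ν : Type} [Fintype ν]

/-- nonradical isotropic vector -/
def NRI {K : Type} [Field K] (γ : Matrix ν ν K) : Prop := ∃ y z, ev γ y = 0 ∧ bl γ y z ≠ 0

lemma quad_irred {K : Type} [Field K] (a b c : K) (hc : c ≠ 0)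
    (h : ∀ θ : K, c * θ ^ 2 + b * θ + a ≠ 0) : Irreducible (C c * X ^ 2 + C b * X + C a : K[X]) := by
  have hd : (C c * X ^ 2 + C b * X + C a : K[X]).natDegree = 2 := natDegree_quadratic hc
  rw [irreducible_iff_roots_eq_zero_of_degree_le_three (by omega) (by omega)]
  rw [Multiset.eq_zero_iff_forall_notMem]
  intro θ hθ
  have := isRoot_of_mem_roots hθ
  simp [IsRoot] at this
  exact h θ this

lemma L6 (h2 : (2 : E) = 0) (XX : ℕ → E) (D : E) (n : ℕ) (hX : ∀ i < n, XX i ≠ 0)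
    (γ : Matrix ν ν E) (z e : ν → E) (hz : bl γ z e ≠ 0) (hc : ev γ e ≠ 0)
    (H : ∀ (K : Type) [Field K] (f : E →+* K), NRI (γ.map f) → ¬ An ((pm XX D n).map f))
    (K : Type) [Field K] (f : E →+* K) (hf : An ((pm XX D n).map f)) (x : ν → K) :
    ∃ p, ev ((pm XX D n).map f) p = f (ev γ e) * ev (γ.map f) x := by
  have case1 : ∀ (K : Type) [Field K] (f : E →+* K) (hf : An ((pm XX D n).map f)) (x : ν → K)
      (hx : bl (γ.map f) x (fun j => f (e j)) ≠ 0),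
      ∃ p, ev ((pm XX D n).map f) p = f (ev γ e) * ev (γ.map f) x := by
    intro K _ f hf x hx
    have h2K : (2 : K) = 0 := two_map f h2
    set ef : ν → K := fun j => f (e j) with hef
    have hcf : f (ev γ e) = ev (γ.map f) ef := by rw [hef, ev_map]
    have hc0 : f (ev γ e) ≠ 0 := by simpa using hc
    set c := f (ev γ e) with hcdef
    set b := bl (γ.map f) x ef with hb
    set a := ev (γ.map f) x with ha
    have hirr := quad_irred a b c hc0 (by
      intro θ hθ
      refine H K f ⟨x + θ • ef, ef, ?_, ?_⟩ hf
      · rw [ev_add, ev_smul, bl_smul_right, ← hcf, ← ha, ← hb, ← hθ]; ring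
      · rw [bl_add_left, bl_smul_left, bl_self, h2K]; simpa using hx)
    set g : K[X] := C c * X ^ 2 + C b * X + C a with hg
    have hgd : g.natDegree = 2 := natDegree_quadratic hc0
    haveI : Fact (Irreducible g) := ⟨hirr⟩
    have hg0 : g ≠ 0 := hirr.ne_zero
    let o : K →+* AdjoinRoot g := AdjoinRoot.of g
    have hroot : o c * AdjoinRoot.root g ^ 2 + o b * AdjoinRoot.root g + o a = 0 := by
      have := AdjoinRoot.eval₂_root g
      simpa [hg, eval₂_add, eval₂_mul] using this
    have hmγ : γ.map (o.comp f) = (γ.map f).map o := by rw [Matrix.map_map]; rfl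
    have hmπ : (pm XX D n).map (o.comp f) = ((pm XX D n).map f).map o := by rw [Matrix.map_map]; rfl
    have hiso := H (AdjoinRoot g) (o.comp f) (by
      refine ⟨(fun j => o (x j)) + AdjoinRoot.root g • (fun j => o (ef j)), fun j => o (ef j), ?_, ?_⟩
      · rw [hmγ, ev_add, ev_smul, bl_smul_right, ev_map, ev_map, bl_map, ← hcf, ← hb, ← ha, ← hroot]
        ring
      · rw [hmγ, bl_add_left, bl_smul_left, bl_self, bl_map, two_map o h2K, zero_mul, mul_zero,
          add_zero]
        simpa using hx)
    rw [hmπ, an_iff_of_iso_not] at hiso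
    obtain ⟨v, hv0, hv⟩ := hiso
    choose P hP using fun i => AdjoinRoot.mk_surjective (v i)
    set Q : PI n → K[X] := fun i => P i % g with hQ
    have hQv : ∀ i, AdjoinRoot.mk g (Q i) = v i := by
      intro i
      rw [← hP i, AdjoinRoot.mk_eq_mk]
      exact ⟨-(P i / g), by
        have := EuclideanDomain.div_add_mod (P i) g
        show P i % g - P i = _
        linear_combination this⟩
    have hQd : ∀ i, (Q i).natDegree ≤ 1 := by
      intro i
      have := natDegree_mod_lt (P i) (q := g) (by omega)
      show (P i % g).natDegree ≤ 1
      omega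
    have hdvd : g ∣ ev (((pm XX D n).map f).map C) Q := by
      rw [← AdjoinRoot.mk_eq_zero, ← ev_map, ← hv]
      congr 1
      funext i; exact hQv i
    obtain ⟨hh, hhe⟩ := hdvd
    have hhd : hh.natDegree = 0 := by
      by_cases hh0 : hh = 0
      · simp [hh0]
      · have h1 := natDegree_ev_le ((pm XX D n).map f) Q 1 hQd
        rw [hhe, natDegree_mul hg0 hh0] at h1
        omega
    obtain ⟨h0, rfl⟩ := natDegree_eq_zero.1 hhd
    set p0 : PI n → K := fun i => (Q i).coeff 0
    set p1 : PI n → K := fun i => (Q i).coeff 1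
    have e0 : ev ((pm XX D n).map f) p0 = h0 * a := by
      have := coeff_zero_ev ((pm XX D n).map f) Q
      rw [← this, hhe, hg, coeff_mul_C]; simp; ring
    have e1 : ev ((pm XX D n).map f) p1 = h0 * c := by
      have := coeff_ev ((pm XX D n).map f) Q 1 hQd
      rw [← this, hhe, hg, coeff_mul_C]; simp [coeff_X, coeff_C]; ring
    have hh0 : h0 ≠ 0 := by
      rintro rfl
      rw [zero_mul] at e0 e1
      have f0 := hf _ e0
      have f1 := hf _ e1
      apply hv0
      funext i
      rw [← hQv i, eq_X_add_C_of_natDegree_le_one (hQd i)]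
      have g0 := congrFun f0 i
      have g1 := congrFun f1 i
      simp only [p0, p1, Pi.zero_apply] at g0 g1
      simp [g0, g1]
    have hmc := mul_closed h2K (fun i => f (XX i)) (f D) n (fun i hi => by simpa using hX i hi) p0 p1
    rw [← pm_map, e0, e1] at hmc
    obtain ⟨w, hw⟩ := hmc
    refine ⟨h0⁻¹ • w, ?_⟩
    rw [ev_smul, hw]; field_simp
  by_cases hx : bl (γ.map f) x (fun j => f (e j)) = 0
  · have h2K : (2 : K) = 0 := two_map f h2
    have hmγ : γ.map ((iF K).comp f) = (γ.map f).map (iF K) := by rw [Matrix.map_map]; rfl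
    have hmπ : (pm XX D n).map ((iF K).comp f) = ((pm XX D n).map f).map (iF K) := by
      rw [Matrix.map_map]; rfl
    set t : RF K := algebraMap K[X] (RF K) X with ht
    have ht0 : t ≠ 0 := by
      intro h
      exact X_ne_zero (IsFractionRing.injective K[X] (RF K) (h.trans (map_zero _).symm))
    have hiC : ∀ a : K, iF K a = algebraMap K[X] (RF K) (C a) := fun a => rfl
    have e3 := bl_map (iF K) (γ.map f) x (fun j => f (e j))
    have e4 := bl_map (iF K) (γ.map f) (fun j => f (z j)) (fun j => f (e j))
    obtain ⟨p, hp⟩ := case1 (RF K) ((iF K).comp f) (by rw [hmπ]; exact an_RF _ hf)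
      ((fun j => iF K (x j)) + t • (fun j => iF K (f (z j)))) (by
        rw [hmγ, bl_add_left, bl_smul_left]
        show bl _ _ (fun j => iF K (f (e j))) + _ * bl _ _ (fun j => iF K (f (e j))) ≠ 0
        rw [e3, e4, hx, map_zero, zero_add, bl_map]
        refine mul_ne_zero ht0 ?_
        simpa using hz)
    rw [hmγ, hmπ, ev_add, ev_smul, bl_smul_right, ev_map, ev_map, bl_map] at hp
    obtain ⟨p0, p1, q1, -⟩ := cp_lin (μ := Empty) h2K _ hf (fun i => i.elim)
      (f (ev γ e) * ev (γ.map f) x)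
      (f (ev γ e) * bl (γ.map f) x (fun j => f (z j)))
      (f (ev γ e) * ev (γ.map f) (fun j => f (z j))) (fun i => i.elim) (fun i => i.elim) p (by
        rw [hp]; simp only [hiC, t, map_add, map_mul, map_pow, RingHom.comp_apply]; ring)
      (fun i => i.elim)
    exact ⟨p0, q1⟩
  · exact case1 K f hf x hx

end L6
end HS

namespace HS
open Matrix

section GF

/-- generic point field -/
abbrev GR (N : ℕ) (E : Type) [Field E] := FractionRing (MvPolynomial (Fin N) E)
/-- constants -/
noncomputable abbrev cR (N : ℕ) (E : Type) [Field E] : E →+* GR N E :=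
  (algebraMap (MvPolynomial (Fin N) E) (GR N E)).comp MvPolynomial.C

lemma an_GR {κ : Type} [Fintype κ] {E : Type} [Field E] (N : ℕ) (q : Matrix κ κ E) (h : An q) :
    An (q.map (cR N E)) := by
  have := an_frac (L := GR N E) _ (an_mv q h N)
  rwa [Matrix.map_map] at this

variable {N : ℕ}

lemma eval_bl {A : Type} [CommRing A] (q : Matrix (Fin N) (Fin N) A) (x u : Fin N → A) :
    MvPolynomial.eval x (bl (q.map MvPolynomial.C) MvPolynomial.X (fun i => MvPolynomial.C (u i)))
      = bl q x u := by
  have := bl_map (MvPolynomial.eval x) (q.map MvPolynomial.C) MvPolynomial.X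
    (fun i => MvPolynomial.C (u i))
  rw [← this]
  simp only [MvPolynomial.eval_X, MvPolynomial.eval_C]
  congr 1
  ext; simp

/-- polynomial `bl(X,u)` -/
noncomputable abbrev blP {A : Type} [CommRing A] (q : Matrix (Fin N) (Fin N) A) (u : Fin N → A) :
    MvPolynomial (Fin N) A :=
  bl (q.map MvPolynomial.C) MvPolynomial.X (fun i => MvPolynomial.C (u i))

lemma blP_ne {A : Type} [CommRing A] (q : Matrix (Fin N) (Fin N) A) (x u : Fin N → A)
    (h : bl q x u ≠ 0) : blP q u ≠ 0 := by
  intro h0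
  apply h
  exact (eval_bl q x u).symm.trans ((congrArg _ h0).trans (map_zero _))

variable {E : Type} [Field E]

/-- value at generic point -/
noncomputable abbrev evP {A : Type} [CommRing A] (q : Matrix (Fin N) (Fin N) A) :
    MvPolynomial (Fin N) A := ev (q.map MvPolynomial.C) MvPolynomial.X

open Polynomial in
/-- the quadratic polynomial defining the generic field -/
noncomputable def gpol (γ : Matrix (Fin N) (Fin N) E) (e : Fin N → E) : (GR N E)[X] :=
  C (cR N E (ev γ e)) * X ^ 2 + C (algebraMap _ (GR N E) (blP γ e)) * X
    + C (algebraMap _ (GR N E) (evP γ))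

/-- generic vector -/
noncomputable def gS (N : ℕ) (E : Type) [Field E] : Fin N → GR N E :=
  fun i => algebraMap (MvPolynomial (Fin N) E) _ (MvPolynomial.X i)

lemma ev_gS (γ : Matrix (Fin N) (Fin N) E) :
    ev (γ.map (cR N E)) (gS N E) = algebraMap _ (GR N E) (evP γ) := by
  have := ev_map (algebraMap _ (GR N E)) (γ.map MvPolynomial.C) MvPolynomial.X
  rw [Matrix.map_map] at this
  exact this

lemma bl_gS (γ : Matrix (Fin N) (Fin N) E) (e : Fin N → E) :
    bl (γ.map (cR N E)) (gS N E) (fun j => cR N E (e j)) = algebraMap _ (GR N E) (blP γ e) := by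
  have := bl_map (algebraMap _ (GR N E)) (γ.map MvPolynomial.C) MvPolynomial.X
    (fun i => MvPolynomial.C (e i))
  rw [Matrix.map_map] at this
  exact this

lemma alg_ne {p : MvPolynomial (Fin N) E} (h : p ≠ 0) : algebraMap _ (GR N E) p ≠ 0 := fun h0 =>
  h (IsFractionRing.injective _ (GR N E) (h0.trans (map_zero _).symm))

lemma gpol_irred (h2 : (2 : E) = 0) (γ : Matrix (Fin N) (Fin N) E) (hγ : An γ) (z e : Fin N → E)
    (hz : bl γ z e ≠ 0) (hc : ev γ e ≠ 0) : Irreducible (gpol γ e) := by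
  refine quad_irred _ _ _ (by simpa using hc) ?_
  intro θ hθ
  have h1 : ev (γ.map (cR N E)) (gS N E + θ • fun j => cR N E (e j)) = 0 := by
    rw [ev_add, ev_smul, bl_smul_right, ev_gS, bl_gS, ev_map, ← hθ]; ring
  have h3 := an_GR N γ hγ _ h1
  have h4 : bl (γ.map (cR N E)) (gS N E + θ • fun j => cR N E (e j)) (fun j => cR N E (e j)) = 0 := by
    rw [h3, bl_zero_left]
  rw [bl_add_left, bl_smul_left, bl_self, two_map (cR N E) h2, zero_mul, mul_zero, add_zero,
    bl_gS] at h4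
  exact alg_ne (blP_ne γ z e hz) h4

/-- the generic field -/
abbrev GFd (γ : Matrix (Fin N) (Fin N) E) (e : Fin N → E) := AdjoinRoot (gpol γ e)
/-- its structure map -/
noncomputable abbrev cG (γ : Matrix (Fin N) (Fin N) E) (e : Fin N → E) : E →+* GFd γ e :=
  (AdjoinRoot.of (gpol γ e)).comp (cR N E)

lemma GF_nri (h2 : (2 : E) = 0) (γ : Matrix (Fin N) (Fin N) E) (z e : Fin N → E)
    (hz : bl γ z e ≠ 0) [Fact (Irreducible (gpol γ e))] : NRI (γ.map (cG γ e)) := by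
  set o := AdjoinRoot.of (gpol γ e)
  have hm : γ.map (cG γ e) = (γ.map (cR N E)).map o := by rw [Matrix.map_map]; rfl
  have hroot : o (cR N E (ev γ e)) * AdjoinRoot.root (gpol γ e) ^ 2 +
      o (algebraMap _ (GR N E) (blP γ e)) * AdjoinRoot.root (gpol γ e)
      + o (algebraMap _ (GR N E) (evP γ)) = 0 := by
    have : Polynomial.eval₂ o (AdjoinRoot.root (gpol γ e))
      (Polynomial.C (cR N E (ev γ e)) * Polynomial.X ^ 2 +
        Polynomial.C (algebraMap _ (GR N E) (blP γ e)) * Polynomial.X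
        + Polynomial.C (algebraMap _ (GR N E) (evP γ))) = 0 := AdjoinRoot.eval₂_root (gpol γ e)
    simpa [Polynomial.eval₂_add, Polynomial.eval₂_mul] using this
  refine ⟨(fun j => o (gS N E j)) + AdjoinRoot.root (gpol γ e) • (fun j => o (cR N E (e j))),
    fun j => o (cR N E (e j)), ?_, ?_⟩
  · rw [hm, ev_add, ev_smul, bl_smul_right, ev_map, bl_map, ev_map o _ (fun j => cR N E (e j)),
      ev_gS, bl_gS, ev_map, ← hroot]; ring
  · rw [hm, bl_add_left, bl_smul_left, bl_self, bl_map, two_map o (two_map (cR N E) h2), bl_gS,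
      zero_mul, mul_zero, add_zero]
    have := alg_ne (blP_ne γ z e hz)
    simpa using this

lemma GF_inj {K : Type} [Field K] (h2 : (2 : K) = 0) (γ : Matrix (Fin N) (Fin N) K)
    (z e y z' : Fin N → K) (hz : bl γ z e ≠ 0) (hc : ev γ e ≠ 0) (hy : ev γ y = 0)
    (hyz : bl γ y z' ≠ 0) (p : MvPolynomial (Fin N) K)
    (T : Fin N → MvPolynomial (Fin (N+1)) K) (hT : T = fun i => MvPolynomial.X i.castSucc)
    (hp : MvPolynomial.aeval ((ev (γ.map MvPolynomial.C) T • (fun i => MvPolynomial.C (y i)) +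
      bl (γ.map MvPolynomial.C) T (fun i => MvPolynomial.C (y i)) • T +
      (MvPolynomial.X (Fin.last N) : MvPolynomial (Fin (N+1)) K) • (fun i => MvPolynomial.C (e i)) :
        Fin N → MvPolynomial (Fin (N+1)) K)) p = 0) : p = 0 := by
  let L := AlgebraicClosure K
  let f : K →+* L := algebraMap K L
  have h2L : (2 : L) = 0 := two_map f h2
  set γL := γ.map f with hγL
  set eL : Fin N → L := fun i => f (e i) with heL
  set yL : Fin N → L := fun i => f (y i) with hyL
  have hcL : ev γL eL ≠ 0 := by rw [hγL, heL, ev_map]; simpa using hc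
  have hyL0 : ev γL yL = 0 := by rw [hγL, hyL, ev_map, hy, map_zero]
  have hbe : bl γL (fun i => f (z i)) eL ≠ 0 := by rw [hγL, heL, bl_map]; simpa using hz
  have hby : bl γL (fun i => f (z' i)) yL ≠ 0 := by
    rw [hγL, hyL, bl_map, bl_comm]; simpa using hyz
  have hprod : MvPolynomial.map f p * blP γL eL * blP γL yL = 0 := by
    refine MvPolynomial.funext fun s => ?_
    rw [map_mul, map_mul, eval_bl, eval_bl, map_zero]
    by_cases hse : bl γL s eL = 0
    · rw [hse]; ring
    by_cases hsy : bl γL s yL = 0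
    · rw [hsy]; ring
    have hroot : ∃ θ : L, ev γL (s + θ • eL) = 0 ∧ bl γL (s + θ • eL) yL ≠ 0 := by
      obtain ⟨θ, hθ⟩ := IsAlgClosed.exists_root
        (Polynomial.C (ev γL eL) * Polynomial.X ^ 2 + Polynomial.C (bl γL s eL) * Polynomial.X +
          Polynomial.C (ev γL s)) (by
            rw [Polynomial.degree_quadratic hcL]; decide)
      simp [Polynomial.IsRoot] at hθ
      have h1 : ev γL (s + θ • eL) = 0 := by
        rw [ev_add, ev_smul, bl_smul_right, ← hθ]; ring
      by_cases h3 : bl γL (s + θ • eL) yL = 0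
      · refine ⟨θ + bl γL s eL / ev γL eL, ?_, ?_⟩
        · rw [ev_add, ev_smul, bl_smul_right]
          have hr : bl γL s eL / ev γL eL * ev γL eL = bl γL s eL := div_mul_cancel₀ _ hcL
          set r := bl γL s eL / ev γL eL
          linear_combination hθ + r * hr + (θ * r * ev γL eL + r * bl γL s eL) * h2L
        · rw [bl_add_left, bl_smul_left] at h3 ⊢
          have h4 : bl γL eL yL ≠ 0 := by
            intro h4; rw [h4, mul_zero, add_zero] at h3; exact hsy h3
          have h5 : bl γL s yL + (θ + bl γL s eL / ev γL eL) * bl γL eL yL =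
            bl γL s eL / ev γL eL * bl γL eL yL := by linear_combination h3
          rw [h5]
          exact mul_ne_zero (div_ne_zero hse hcL) h4
      · exact ⟨θ, h1, h3⟩
    obtain ⟨θ, hθ1, hθ2⟩ := hroot
    set v := s + θ • eL with hv
    set l := bl γL v yL with hl
    obtain ⟨μ, hμ⟩ := IsAlgClosed.exists_pow_nat_eq (l⁻¹) (n := 2) (by norm_num)
    let φ : MvPolynomial (Fin (N+1)) K →+* L :=
      MvPolynomial.eval₂Hom f (Fin.snoc (α := fun _ => L) (μ • v) θ)
    have hφC : ∀ a, φ (MvPolynomial.C a) = f a := fun a => MvPolynomial.eval₂Hom_C ..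
    have hφT : (fun i => φ (T i)) = μ • v := by
      funext i; rw [hT]; simp [φ]
    have hφγ : (γ.map MvPolynomial.C).map φ = γL := by
      rw [Matrix.map_map]; ext i j; simp [hγL, hφC]
    have hφl : φ (MvPolynomial.X (Fin.last N)) = θ := by simp [φ]
    have h1 := congrArg φ hp
    rw [map_zero, MvPolynomial.aeval_def, ← MvPolynomial.coe_eval₂Hom] at h1
    have h3 : φ.comp (MvPolynomial.eval₂Hom (algebraMap K (MvPolynomial (Fin (N+1)) K))
      (ev (γ.map MvPolynomial.C) T • (fun i => MvPolynomial.C (y i)) +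
      bl (γ.map MvPolynomial.C) T (fun i => MvPolynomial.C (y i)) • T +
      (MvPolynomial.X (Fin.last N) : MvPolynomial (Fin (N+1)) K) • (fun i => MvPolynomial.C (e i)) :
        Fin N → MvPolynomial (Fin (N+1)) K)) = (MvPolynomial.eval s).comp (MvPolynomial.map f) := by
      apply MvPolynomial.ringHom_ext
      · intro a
        simp [MvPolynomial.algebraMap_eq, hφC]
      · intro i
        simp only [RingHom.comp_apply, MvPolynomial.eval₂Hom_X', MvPolynomial.map_X,
          MvPolynomial.eval_X, Pi.add_apply, Pi.smul_apply, smul_eq_mul, map_add, map_mul, hφC, hφl]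
        have e1 : φ (ev (γ.map MvPolynomial.C) T) = 0 := by
          rw [← ev_map, hφγ, hφT, ev_smul, hθ1, mul_zero]
        have e2 : φ (bl (γ.map MvPolynomial.C) T (fun i => MvPolynomial.C (y i))) = μ * l := by
          rw [← bl_map, hφγ, hφT, bl_smul_left]
          simp only [hφC]; rfl
        have e3 : φ (T i) = μ * v i := congrFun hφT i
        rw [e1, e2, e3]
        have e4 : v i = s i + θ * f (e i) := rfl
        have e5 : μ ^ 2 * l = 1 := by rw [hμ]; exact inv_mul_cancel₀ hθ2
        linear_combination (v i) * e5 + e4 + θ * f (e i) * h2L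
    have h4 := congrArg (fun g => g p) h3
    simp only [RingHom.comp_apply] at h4
    rw [h1] at h4
    rw [← h4]; ring
  have h5 : MvPolynomial.map f p = 0 := by
    rcases mul_eq_zero.1 hprod with h | h
    · rcases mul_eq_zero.1 h with h | h
      · exact h
      · exact absurd h (blP_ne _ _ _ hbe)
    · exact absurd h (blP_ne _ _ _ hby)
  exact MvPolynomial.map_injective f f.injective (h5.trans (map_zero _).symm)

lemma GF_univ (h2 : (2 : E) = 0) (γ : Matrix (Fin N) (Fin N) E) (z e : Fin N → E)
    (hz : bl γ z e ≠ 0) (hc : ev γ e ≠ 0) [Fact (Irreducible (gpol γ e))]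
    (K : Type) [Field K] (f : E →+* K) (h : NRI (γ.map f)) :
    ∃ g : GFd γ e →+* GR (N+1) K, g.comp (cG γ e) = (cR (N+1) K).comp f := by
  obtain ⟨y, z', hy, hyz⟩ := h
  have h2K := two_map f h2
  set γK := γ.map f with hγK
  set eK : Fin N → K := fun i => f (e i) with heK
  have hcK : ev γK eK ≠ 0 := by rw [hγK, heK, ev_map]; simpa using hc
  have hzK : bl γK (fun i => f (z i)) eK ≠ 0 := by rw [hγK, heK, bl_map]; simpa using hz
  let P := MvPolynomial (Fin (N+1)) K
  let T : Fin N → P := fun i => MvPolynomial.X i.castSucc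
  let x : Fin N → P := ev (γK.map MvPolynomial.C) T • (fun i => MvPolynomial.C (y i)) +
      bl (γK.map MvPolynomial.C) T (fun i => MvPolynomial.C (y i)) • T
  let τ : P := MvPolynomial.X (Fin.last N)
  let s : Fin N → P := x + τ • (fun i => MvPolynomial.C (eK i))
  have h2P : (2 : P) = 0 := by
    have := congrArg (MvPolynomial.C (σ := Fin (N+1))) h2K; rwa [map_zero, map_ofNat] at this
  let a : P →+* GR (N+1) K := algebraMap P _
  have hainj : Function.Injective a := IsFractionRing.injective _ _
  -- hom on polynomials
  let φ0 : MvPolynomial (Fin N) E →+* P := MvPolynomial.eval₂Hom (MvPolynomial.C.comp f) s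
  have hφ0 : Function.Injective φ0 := by
    rw [injective_iff_map_eq_zero]
    intro p hp
    have h3 : φ0 p = MvPolynomial.aeval s (MvPolynomial.map f p) := by
      simp only [φ0, MvPolynomial.aeval_def, MvPolynomial.coe_eval₂Hom, MvPolynomial.eval₂_map]
      rfl
    rw [h3] at hp
    have := GF_inj h2K γK _ eK y z' hzK hcK hy hyz _ T rfl hp
    exact MvPolynomial.map_injective f f.injective (this.trans (map_zero _).symm)
  have hφ1 : Function.Injective (a.comp φ0) := hainj.comp hφ0
  let φ : GR N E →+* GR (N+1) K := IsFractionRing.lift hφ1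
  have hφ : ∀ p, φ (algebraMap _ _ p) = a (φ0 p) := fun p => IsFractionRing.lift_algebraMap hφ1 p
  have hφC : ∀ b, φ (cR N E b) = cR (N+1) K (f b) := by
    intro b
    simp only [RingHom.comp_apply, hφ]
    simp [φ0, a]; rfl
  have hφS : (fun i => φ (gS N E i)) = fun i => a (s i) := by
    funext i; simp [gS, hφ, φ0]
  have hφγ : (γ.map (cR N E)).map φ = (γK.map MvPolynomial.C).map a := by
    rw [Matrix.map_map, Matrix.map_map, hγK, Matrix.map_map]
    ext i j; simp only [map_apply, Function.comp_apply, hφC]; rfl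
  have hevS : φ (algebraMap _ (GR N E) (evP γ)) = a (ev (γK.map MvPolynomial.C) s) := by
    rw [← ev_gS, ← ev_map, hφγ, hφS, ev_map]
  have hblS : φ (algebraMap _ (GR N E) (blP γ e)) =
      a (bl (γK.map MvPolynomial.C) s (fun i => MvPolynomial.C (eK i))) := by
    rw [← bl_gS, ← bl_map, hφγ, hφS, ← bl_map]
    simp only [hφC]; rfl
  have hevc : φ (cR N E (ev γ e)) =
      a (ev (γK.map MvPolynomial.C) (fun i => MvPolynomial.C (eK i))) := by
    rw [hφC, ev_map, hγK, heK, ev_map]; rfl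
  have hx0 : ev (γK.map MvPolynomial.C) x = 0 := by
    have hyP : ev (γK.map (MvPolynomial.C : K →+* P)) (fun i => MvPolynomial.C (y i)) = 0 := by
      rw [ev_map, hy, map_zero]
    simp only [x]
    rw [ev_add, ev_smul, ev_smul, bl_smul_left, bl_smul_right, hyP, bl_comm _ (fun i => MvPolynomial.C (y i)) T]
    linear_combination (ev (γK.map MvPolynomial.C) T *
      (bl (γK.map MvPolynomial.C) T (fun i => MvPolynomial.C (y i))) ^ 2) * h2P
  have hsτ : x = s + τ • (fun i => MvPolynomial.C (eK i)) := by
    funext i; simp only [s, Pi.add_apply, Pi.smul_apply, smul_eq_mul]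
    linear_combination (- τ * MvPolynomial.C (eK i)) * h2P
  rw [hsτ, ev_add, ev_smul, bl_smul_right] at hx0
  refine ⟨AdjoinRoot.lift φ (a τ) ?_, ?_⟩
  · unfold gpol
    simp only [Polynomial.eval₂_add, Polynomial.eval₂_mul, Polynomial.eval₂_pow, Polynomial.eval₂_C,
      Polynomial.eval₂_X]
    rw [hevS, hblS, hevc, ← map_pow, ← map_mul, ← map_mul, ← map_add, ← map_add, ← map_zero a]
    congr 1
    rw [← hx0]; ring
  · ext b
    have := AdjoinRoot.lift_of (i := φ) (a := a τ) (f := gpol γ e) (h := by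
      unfold gpol
      simp only [Polynomial.eval₂_add, Polynomial.eval₂_mul, Polynomial.eval₂_pow,
        Polynomial.eval₂_C, Polynomial.eval₂_X]
      rw [hevS, hblS, hevc, ← map_pow, ← map_mul, ← map_mul, ← map_add, ← map_add, ← map_zero a]
      congr 1
      rw [← hx0]; ring) (x := cR N E b)
    simp only [RingHom.comp_apply] at this ⊢
    rw [this]
    exact hφC b

end GF
end HS

namespace HS
open Matrix

section lin
variable {ν κ : Type} [Fintype ν] [Fintype κ]

/-- linear combinations of a family of vectors -/
noncomputable def lc {A : Type} [CommRing A] (w : ν → κ → A) : (ν → A) →ₗ[A] (κ → A) :=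
  Fintype.linearCombination A w

lemma lc_apply {A : Type} [CommRing A] (w : ν → κ → A) (x : ν → A) : lc w x = ∑ i, x i • w i :=
  Fintype.linearCombination_apply A w x

lemma lc_map {A B : Type} [CommRing A] [CommRing B] (f : A →+* B) (w : ν → κ → A) (x : ν → A) :
    lc (fun i j => f (w i j)) (fun i => f (x i)) = fun j => f (lc w x j) := by
  funext j
  simp [lc_apply, Finset.sum_apply]

/-- injective linear combinations -/
def LI {A : Type} [CommRing A] (w : ν → κ → A) : Prop := ∀ x, lc w x = 0 → x = 0

lemma li_map {K L : Type} [Field K] [Field L] (f : K →+* L) (w : ν → κ → K) (h : LI w) :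
    LI (fun i j => f (w i j)) := by
  classical
  obtain ⟨g, hg⟩ := LinearMap.exists_leftInverse_of_injective (lc w)
    (by rw [LinearMap.ker_eq_bot']; exact h)
  have hg' : ∀ a b, (∑ j, w a j * g (Pi.single j 1) b) = if a = b then 1 else 0 := by
    intro a b
    have h1 : lc w (Pi.single a 1) = w a := by
      rw [lc_apply]; simp [Pi.single_apply]
    have h2 : g (w a) = Pi.single a 1 := by
      rw [← h1]; exact LinearMap.congr_fun hg _
    have h3 : w a = ∑ j, w a j • (Pi.single j 1 : κ → K) := by
      funext k; simp [Finset.sum_apply, Pi.single_apply]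
    have h4 := congrFun h2 b
    rw [h3, map_sum, Finset.sum_apply] at h4
    simp only [map_smul, Pi.smul_apply, smul_eq_mul, Pi.single_apply] at h4
    rw [h4]; simp [eq_comm]
  intro x hx
  funext b
  have h1 : ∑ j, lc (fun i j => f (w i j)) x j * f (g (Pi.single j 1) b) = x b := by
    simp only [lc_apply, Finset.sum_apply, Pi.smul_apply, smul_eq_mul, Finset.sum_mul]
    rw [Finset.sum_comm]
    have : ∀ a, ∑ j, x a * f (w a j) * f (g (Pi.single j 1) b) = x a * if a = b then 1 else 0 := by
      intro a
      have := congrArg f (hg' a b)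
      rw [map_sum] at this
      simp only [map_mul] at this
      simp only [mul_assoc]
      rw [← Finset.mul_sum, this]
      split_ifs <;> simp
    rw [Finset.sum_congr rfl fun a _ => this a]
    simp
  rw [← h1, hx]; simp

/-- pull-back of a form -/
def pb {A : Type} [CommRing A] (q : Matrix κ κ A) (w : ν → κ → A) : Matrix ν ν A :=
  Matrix.of fun a b => w a ⬝ᵥ (q *ᵥ w b)

lemma pb_dot {A : Type} [CommRing A] (q : Matrix κ κ A) (w : ν → κ → A) (x y : ν → A) :
    x ⬝ᵥ (pb q w *ᵥ y) = lc w x ⬝ᵥ (q *ᵥ lc w y) := by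
  simp only [lc_apply, sum_dotProduct, mulVec_sum, dotProduct_sum, smul_dotProduct,
    mulVec_smul, dotProduct_smul, smul_eq_mul]
  simp only [dotProduct, mulVec, pb, Matrix.of_apply, Finset.mul_sum]
  rw [Finset.sum_comm]
  refine Finset.sum_congr rfl fun a _ => Finset.sum_congr rfl fun b _ => ?_
  rw [Finset.sum_mul, Finset.mul_sum]
  simp only [Finset.mul_sum, Finset.sum_mul]
  refine Finset.sum_congr rfl fun i _ => Finset.sum_congr rfl fun j _ => by ring

lemma ev_pb {A : Type} [CommRing A] (q : Matrix κ κ A) (w : ν → κ → A) (x : ν → A) :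
    ev (pb q w) x = ev q (lc w x) := pb_dot q w x x

lemma bl_pb {A : Type} [CommRing A] (q : Matrix κ κ A) (w : ν → κ → A) (x y : ν → A) :
    bl (pb q w) x y = bl q (lc w x) (lc w y) := by
  simp only [bl, pb_dot]

lemma pb_map {A B : Type} [CommRing A] [CommRing B] (f : A →+* B) (q : Matrix κ κ A)
    (w : ν → κ → A) : (pb q w).map f = pb (q.map f) (fun i j => f (w i j)) := by
  ext a b
  simp [pb, dotProduct, mulVec, map_sum]

lemma ker_dim {K : Type} [Field K] {V V' : Type} [AddCommGroup V] [Module K V] [AddCommGroup V']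
    [Module K V'] [FiniteDimensional K V] [FiniteDimensional K V'] (f : V →ₗ[K] V')
    (I : Submodule K V') : Module.finrank K V + Module.finrank K I ≤
      Module.finrank K (I.comap f) + Module.finrank K V' := by
  have h1 := LinearMap.finrank_range_add_finrank_ker (I.mkQ.comp f)
  have h2 : LinearMap.ker (I.mkQ.comp f) = I.comap f := by
    rw [LinearMap.ker_comp, Submodule.ker_mkQ]
  rw [h2] at h1
  have h3 := Submodule.finrank_le (LinearMap.range (I.mkQ.comp f))
  have h4 := I.finrank_quotient_add_finrank
  omega

lemma bound {H : Type} [Field H] {μ S : Type} [Fintype μ] [AddCommGroup S] [Module H S]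
    [FiniteDimensional H S] (h2 : (2 : H) = 0)
    (π : Matrix κ κ H) (hnd : Nd π) (φ : Matrix μ μ H) (hφ : An φ) (d : ℕ)
    (hcard : Fintype.card κ = 2 * d) (I : Submodule H (κ → H)) (hI : Module.finrank H I = d)
    (hI0 : ∀ x ∈ I, ev π x = 0)
    (a : S →ₗ[H] (κ → H)) (b : S →ₗ[H] (μ → H)) (hab : ∀ s, ev π (a s) = ev φ (b s))
    (hinj : ∀ s, a s = 0 → b s = 0 → s = 0) : Module.finrank H S ≤ d := by
  have hb0 : ∀ s, ev π (a s) = 0 → b s = 0 := fun s h => hφ _ (by rw [← hab, h])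
  have hainj : Function.Injective a := by
    rw [← LinearMap.ker_eq_bot, LinearMap.ker_eq_bot']
    intro s hs
    exact hinj s hs (hb0 s (by rw [hs, ev_zero]))
  have hbl : ∀ s t, bl π (a s) (a t) = bl φ (b s) (b t) := by
    intro s t
    have := hab (s + t)
    rw [map_add, map_add, ev_add, ev_add, hab, hab] at this
    linear_combination this
  have hdP : Module.finrank H (LinearMap.range a) = Module.finrank H S :=
    LinearMap.finrank_range_of_inj hainj
  have hIbl : ∀ x ∈ I, ∀ y ∈ I, bl π x y = 0 := by
    intro x hx y hy
    have := hI0 _ (I.add_mem hx hy)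
    rw [ev_add, hI0 x hx, hI0 y hy] at this
    simpa using this
  let B : LinearMap.BilinForm H (κ → H) := blm π
  have hB : B.Nondegenerate := by
    constructor
    · intro x hx; exact hnd x hx
    · intro x hx; exact hnd x (fun y => by rw [bl_comm]; exact hx y)
  have horth := LinearMap.BilinForm.finrank_orthogonal hB (LinearMap.range a ⊓ I)
  have hle : LinearMap.range a ⊔ I ≤ B.orthogonal (LinearMap.range a ⊓ I) := by
    rw [sup_le_iff]
    constructor
    · rintro _ ⟨t, rfl⟩
      rw [LinearMap.BilinForm.mem_orthogonal_iff]
      rintro _ ⟨⟨s, rfl⟩, hs⟩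
      show bl π (a s) (a t) = 0
      rw [hbl, hb0 s (hI0 _ hs), bl_zero_left]
    · intro t ht
      rw [LinearMap.BilinForm.mem_orthogonal_iff]
      rintro s ⟨_, hs⟩
      exact hIbl s hs t ht
  have h1 := Submodule.finrank_mono hle
  have h3 := Submodule.finrank_sup_add_finrank_inf_eq (LinearMap.range a) I
  have h4 := Submodule.finrank_mono (inf_le_right : LinearMap.range a ⊓ I ≤ I)
  rw [Module.finrank_fintype_fun_eq_card] at horth
  omega

end lin
end HS

namespace HS
open Matrix

section state
variable {F : Type} [Field F] {M : ℕ}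

/-- The state of the construction. -/
structure Sta (φ : Matrix (Fin M) (Fin M) F) (v : ℕ → Fin M → F) (n i : ℕ) where
  E : Type
  [fE : Field E]
  H : Type
  [fH : Field H]
  jF : F →+* E
  jH : E →+* H
  X : ℕ → E
  D : E
  u : ℕ → PI n → E
  hX : ∀ l < n, X l ≠ 0
  anE : An (pm X D n)
  isH : ¬ An ((pm X D n).map jH)
  anφ : An (φ.map (jH.comp jF))
  hev : ∀ l < i, ev (pm X D n) (u l) = jF (ev φ (v l))
  hbl : ∀ l < i, ∀ k < i, bl (pm X D n) (u l) (u k) = jF (bl φ (v l) (v k))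

open Polynomial

lemma an_art (F : Type) [Field F] : An (ι := PI 0) ((pm (fun _ => (1:RF F)) (algebraMap F[X] (RF F) X) 0)) := by
  have h1 : An (ι := PI 0) (pm (fun _ => (1 : F[X])) X 0) := by
    intro w hw
    have hw' := (ev_pm_zero (fun _ => (1 : F[X])) X w).symm.trans hw
    have hw'' : w (0 : Fin 2) ^ 2 + w (0 : Fin 2) * w (1 : Fin 2) + X * w (1 : Fin 2) ^ 2 = 0 := hw'
    have h1 : w (1 : Fin 2) = 0 := by
      by_contra hne
      have h0 : w (0 : Fin 2) ≠ 0 := by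
        intro h0; rw [h0] at hw''
        have : X * w (1 : Fin 2) ^ 2 = 0 := by linear_combination hw''
        exact (mul_ne_zero X_ne_zero (pow_ne_zero _ hne)) this
      set a := w (0 : Fin 2)
      set b := w (1 : Fin 2)
      have ha2 : (a ^ 2).natDegree = 2 * a.natDegree := by rw [natDegree_pow]
      have hb2 : (X * b ^ 2).natDegree = 2 * b.natDegree + 1 := by
        rw [natDegree_mul X_ne_zero (pow_ne_zero _ hne), natDegree_pow, natDegree_X, add_comm]
      have hab : (a * b).natDegree = a.natDegree + b.natDegree := natDegree_mul h0 hne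
      rcases le_or_gt a.natDegree b.natDegree with hle | hlt
      · have e : X * b ^ 2 = -(a ^ 2 + a * b) := by linear_combination hw''
        have := congrArg natDegree e
        rw [natDegree_neg, hb2] at this
        have h3 := natDegree_add_le (a ^ 2) (a * b)
        rw [ha2, hab] at h3
        have : max (2 * a.natDegree) (a.natDegree + b.natDegree) ≤ 2 * b.natDegree := max_le (by omega) (by omega)
        omega
      · have e : a ^ 2 = -(a * b + X * b ^ 2) := by linear_combination hw''
        have := congrArg natDegree e
        rw [natDegree_neg, ha2] at this
        have h3 := natDegree_add_le (a * b) (X * b ^ 2)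
        rw [hb2, hab] at h3
        have : max (a.natDegree + b.natDegree) (2 * b.natDegree + 1) ≤ 2 * a.natDegree - 1 := max_le (by omega) (by omega)
        omega
    have h0 : w (0 : Fin 2) = 0 := by
      rw [h1] at hw''
      have : w (0 : Fin 2) ^ 2 = 0 := by linear_combination hw''
      exact pow_eq_zero_iff (two_ne_zero) |>.1 this
    funext i
    have : ∀ i : Fin 2, w i = 0 := by
      intro i; fin_cases i
      · exact h0
      · exact h1
    exact this i
  have h2 := an_frac (L := RF F) _ h1
  rw [pm_map] at h2
  simpa using h2

/-- functoriality of rational functions -/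
noncomputable def RFmap {E H : Type} [Field E] [Field H] (j : E →+* H) : RF E →+* RF H :=
  IsFractionRing.lift (A := E[X]) (K := RF E) (L := RF H) (g := (algebraMap H[X] (RF H)).comp (mapRingHom j))
    (by
      rw [RingHom.coe_comp]
      exact (IsFractionRing.injective H[X] (RF H)).comp (Polynomial.map_injective j j.injective))

lemma RFmap_alg {E H : Type} [Field E] [Field H] (j : E →+* H) (p : E[X]) :
    RFmap j (algebraMap E[X] (RF E) p) = algebraMap H[X] (RF H) (p.map j) := by
  rw [RFmap, IsFractionRing.lift_algebraMap]; rfl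

/-- the Artin-Schreier substitution -/
noncomputable def ASmap (F : Type) [Field F] : RF F →+* RF F :=
  IsFractionRing.lift (A := F[X]) (K := RF F) (L := RF F)
    (g := (algebraMap F[X] (RF F)).comp (compRingHom (-(X ^ 2 + X))))
    (by
      rw [RingHom.coe_comp]
      refine (IsFractionRing.injective F[X] (RF F)).comp ?_
      have hd : (-(X ^ 2 + X) : F[X]).natDegree = 2 := by rw [natDegree_neg]; compute_degree!
      rw [injective_iff_map_eq_zero]
      intro p hp
      have hp' : p.comp (-(X ^ 2 + X)) = 0 := hp
      rw [comp_eq_zero_iff] at hp'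
      rcases hp' with h | ⟨_, h⟩
      · exact h
      · rw [h, natDegree_C] at hd; omega)

lemma ASmap_alg (F : Type) [Field F] (p : F[X]) :
    ASmap F (algebraMap F[X] (RF F) p) = algebraMap F[X] (RF F) (p.comp (-(X ^ 2 + X))) := by
  rw [ASmap, IsFractionRing.lift_algebraMap]; rfl

lemma sta_base (φ : Matrix (Fin M) (Fin M) F) (hφ : An φ) (v : ℕ → Fin M → F) (n : ℕ) :
    Nonempty (Sta φ v n 0) := by
  induction n with
  | zero =>
    refine ⟨{ E := RF F, H := RF F, jF := iF F, jH := ASmap F, X := fun _ => 1,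
              D := algebraMap F[X] (RF F) X, u := fun _ => 0, hX := fun _ _ => one_ne_zero,
              anE := an_art F, isH := ?_, anφ := ?_, hev := by intro l hl; omega,
              hbl := by intro l hl; omega }⟩
    · rw [an_iff_of_iso_not, pm_map]
      refine ⟨(![algebraMap F[X] (RF F) X, 1] : Fin 2 → RF F), ?_, ?_⟩
      · intro h
        have := congrFun h (1 : Fin 2)
        exact one_ne_zero this
      · refine (ev_pm_zero _ _ _).trans ?_
        rw [ASmap_alg]
        simp
    · have : (ASmap F).comp (iF F) = iF F := by
        ext a
        simp [ASmap_alg]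
      rw [this]; exact an_RF φ hφ
  | succ n ih =>
    obtain ⟨S⟩ := ih
    letI := S.fE
    letI := S.fH
    let X' : ℕ → RF S.E := fun l => if l < n then iF S.E (S.X l) else algebraMap S.E[X] (RF S.E) X
    have hX' : ∀ l < n, X' l = iF S.E (S.X l) := fun l hl => if_pos hl
    have hXn : X' n = algebraMap S.E[X] (RF S.E) X := if_neg (lt_irrefl n)
    have hpm : pm X' (iF S.E S.D) n = (pm S.X S.D n).map (iF S.E) := by
      rw [pm_map]; exact pm_congr _ _ _ _ hX'
    have hj : ∀ a : S.E, RFmap S.jH (iF S.E a) = iF S.H (S.jH a) := by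
      intro a
      simp only [iF, RingHom.comp_apply, RFmap_alg, map_C]
    have tX : algebraMap S.E[X] (RF S.E) X ≠ 0 := by
      intro h
      exact X_ne_zero (IsFractionRing.injective S.E[X] (RF S.E) (h.trans (map_zero _).symm))
    refine ⟨{ E := RF S.E, H := RF S.H, jF := (iF S.E).comp S.jF, jH := RFmap S.jH, X := X',
              D := iF S.E S.D, u := fun _ => 0, hX := ?_,
              anE := ?_, isH := ?_, anφ := ?_, hev := by intro l hl; omega,
              hbl := by intro l hl; omega }⟩
    · intro l hl
      rcases Nat.lt_succ_iff_lt_or_eq.1 hl with h | h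
      · rw [hX' l h]; simpa using S.hX l h
      · rw [h, hXn]; exact tX
    · let Y : ℕ → S.E[X] := fun l => if l < n then C (S.X l) else X
      have hYn : Y n = X := if_neg (lt_irrefl n)
      have hY : pm Y (C S.D) n = (pm S.X S.D n).map C := by
        rw [pm_map]; exact pm_congr _ _ _ _ (fun l hl => if_pos hl)
      have h1 : An (pm Y (C S.D) (n+1)) := by
        intro w hw
        obtain ⟨u, v, rfl⟩ := elim_surj (α := PI n) (β := PI n) w
        have hw' := (ev_pm_succ Y (C S.D) n u v).symm.trans hw
        rw [hY, hYn] at hw'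
        obtain ⟨h1, h2⟩ := an_poly_twist _ S.anE u v hw'
        rw [h1, h2]
        funext k
        rcases k with k | k <;> rfl
      have h2 := an_frac (L := RF S.E) _ h1
      rw [pm_map] at h2
      have : (fun l => algebraMap S.E[X] (RF S.E) (Y l)) = X' := by
        funext l
        simp only [Y, X']
        split_ifs <;> rfl
      rw [this] at h2
      exact h2
    · obtain ⟨x, hx, hx0⟩ := an_iff_of_iso_not.1 S.isH
      rw [an_iff_of_iso_not, pm_map]
      refine ⟨(Sum.elim (fun k => iF S.H (x k)) 0 : PI n ⊕ PI n → RF S.H), ?_, ?_⟩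
      · intro h
        apply hx
        funext k
        have := congrFun h (Sum.inl k : PI n ⊕ PI n)
        have h' : iF S.H (x k) = 0 := this
        simpa using h'
      · refine (ev_pm_succ _ _ n _ _).trans ?_
        rw [ev_zero, mul_zero, add_zero]
        rw [← pm_map, hpm, Matrix.map_map]
        have h3 : ((pm S.X S.D n).map S.jH).map (iF S.H) = (pm S.X S.D n).map (⇑(RFmap S.jH) ∘ ⇑(iF S.E)) := by
          rw [Matrix.map_map]
          congr 1
          funext a
          exact (hj a).symm
        rw [← h3, ev_map, hx0, map_zero]
    · have : (RFmap S.jH).comp ((iF S.E).comp S.jF) = (iF S.H).comp (S.jH.comp S.jF) := by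
        ext a
        exact hj _
      rw [this]
      have := an_RF _ S.anφ
      rwa [Matrix.map_map] at this

end state
end HS

namespace HS
open Matrix

section stepA

/-- one-dimensional form -/
def one1 {A : Type} (α : A) : Matrix Unit Unit A := Matrix.of fun _ _ => α

lemma ev_one1 {A : Type} [CommRing A] (α : A) (y : Unit → A) : ev (one1 α) y = α * y () ^ 2 := by
  simp [ev, one1, dotProduct, mulVec]; ring

/-- `π ⊥ ⟨α⟩` -/
def QQ {κ A : Type} [CommRing A] (π : Matrix κ κ A) (α : A) : Matrix (κ ⊕ Unit) (κ ⊕ Unit) A :=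
  fromBlocks π 0 0 (one1 α)

lemma QQ_map {κ A B : Type} [CommRing A] [CommRing B] (f : A →+* B) (π : Matrix κ κ A) (α : A) :
    (QQ π α).map f = QQ (π.map f) (f α) := by
  unfold QQ
  rw [fromBlocks_map]
  congr 1 <;> ext <;> simp [one1]

variable {κ : Type} [Fintype κ]

lemma ev_QQ {K : Type} [Field K] (π : Matrix κ κ K) (α : K) (y : κ ⊕ Unit → K) :
    ev (QQ π α) y = ev π (pl y) + α * y (Sum.inr ()) ^ 2 := by
  obtain ⟨u, v, rfl⟩ := elim_surj y
  rw [QQ, ev_fromBlocks, ev_one1]; rfl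

lemma bl_QQ {K : Type} [Field K] (h2 : (2 : K) = 0) (π : Matrix κ κ K) (α : K) (y y' : κ ⊕ Unit → K) :
    bl (QQ π α) y y' = bl π (pl y) (pl y') := by
  obtain ⟨u, v, rfl⟩ := elim_surj y
  obtain ⟨u', v', rfl⟩ := elim_surj y'
  rw [QQ, bl_fromBlocks]
  have : bl (one1 α) v v' = 0 := by
    simp [bl, one1, dotProduct, mulVec]
    linear_combination (v () * α * v' ()) * h2
  rw [this, add_zero]; rfl

lemma rel_lc {K : Type} [Field K] {ν : Type} [Fintype ν] (π : Matrix κ κ K) (w : ν → κ ⊕ Unit → K)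
    (p : κ → K) (β : K)
    (h : ∀ a, bl π p (pl (w a)) = w a (Sum.inr ()) * β) (x : ν → K) :
    bl π p (pl (lc w x)) = lc w x (Sum.inr ()) * β := by
  have : bl π p (pl (lc w x)) = ∑ a, x a * bl π p (pl (w a)) := by
    rw [lc_apply, map_sum, ← blm_apply, map_sum]
    refine Finset.sum_congr rfl fun a _ => ?_
    rw [map_smul, map_smul]; rfl
  rw [this, lc_apply, Finset.sum_apply, Finset.sum_mul]
  refine Finset.sum_congr rfl fun a _ => ?_
  rw [h a]; simp; ring

lemma rel_lc2 {K : Type} [Field K] {τ : Type} [Fintype τ] (π : Matrix κ κ K) (u : τ → κ → K)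
    (p : κ → K) (t : K) (β : τ → K) (h : ∀ l, bl π (u l) p = t * β l) (c : τ → K) :
    bl π (lc u c) p = t * (c ⬝ᵥ β) := by
  rw [lc_apply, ← blm_apply, map_sum, LinearMap.sum_apply, dotProduct, Finset.mul_sum]
  refine Finset.sum_congr rfl fun a _ => ?_
  rw [map_smul, LinearMap.smul_apply, blm_apply, h a]; simp; ring

lemma exists_w {E : Type} [Field E] (π : Matrix κ κ E) (i : ℕ) (u : Fin i → κ → E) (β : Fin i → E) :
    ∃ (N : ℕ) (w : Fin N → κ ⊕ Unit → E), Fintype.card κ + 1 ≤ N + i ∧ LI w ∧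
      ∀ l a, bl π (u l) (pl (w a)) = w a (Sum.inr ()) * β l := by
  let Φ : (κ ⊕ Unit → E) →ₗ[E] (Fin i → E) :=
    LinearMap.pi fun l => (blm π (u l)).comp pl - β l • LinearMap.proj (Sum.inr ())
  have hΦ : ∀ y l, Φ y l = bl π (u l) (pl y) - β l * y (Sum.inr ()) := fun y l => rfl
  have hdim := LinearMap.finrank_range_add_finrank_ker Φ
  have hr := Submodule.finrank_le (LinearMap.range Φ)
  rw [Module.finrank_fintype_fun_eq_card, Fintype.card_sum, Fintype.card_unit] at hdim
  rw [Module.finrank_fintype_fun_eq_card, Fintype.card_fin] at hr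
  let b := Module.finBasis E (LinearMap.ker Φ)
  refine ⟨_, fun a => (b a : κ ⊕ Unit → E), by omega, ?_, ?_⟩
  · intro x hx
    rw [lc_apply] at hx
    have h1 : ∑ a, x a • b a = 0 := by
      apply Subtype.ext
      refine Eq.trans ?_ hx
      simp
    funext a
    exact Fintype.linearIndependent_iff.1 b.linearIndependent x h1 a
  · intro l a
    have h1 : Φ (b a) = 0 := (b a).2
    have h2 := congrFun h1 l
    rw [hΦ] at h2
    rw [mul_comm]
    exact sub_eq_zero.1 h2

lemma nri_H {H : Type} [Field H] (h2 : (2 : H) = 0) {μ : Type} [Fintype μ]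
    (π : Matrix κ κ H) (hnd : Nd π) (φ : Matrix μ μ H) (hφ : An φ) (d : ℕ)
    (hcard : Fintype.card κ = 2 * d) (I : Submodule H (κ → H)) (hI : Module.finrank H I = d)
    (hI0 : ∀ x ∈ I, ev π x = 0) (i N : ℕ) (hi : i < d)
    (u : Fin i → κ → H) (β : Fin i → H) (v : Fin i → μ → H) (hv : LI v)
    (huv : ∀ c, ev π (lc u c) = ev φ (lc v c))
    (w : Fin N → κ ⊕ Unit → H) (hN : 2 * d + 1 ≤ N + i) (hw : LI w)
    (hrel : ∀ l a, bl π (u l) (pl (w a)) = w a (Sum.inr ()) * β l) (α : H) :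
    NRI (pb (QQ π α) w) := by
  let ι0 : (κ → H) →ₗ[H] (κ ⊕ Unit → H) := elimL LinearMap.id 0
  have hι0 : Function.Injective ι0 := by
    intro a b hab
    have := congrArg pl hab
    exact this
  have hI' : Module.finrank H (I.map ι0) = d := by
    rw [← hI]; exact LinearEquiv.finrank_eq (Submodule.equivMapOfInjective ι0 hι0 I).symm
  have hk := ker_dim (lc w) (I.map ι0)
  rw [hI', Module.finrank_fintype_fun_eq_card, Module.finrank_fintype_fun_eq_card, Fintype.card_sum,
    Fintype.card_unit, Fintype.card_fin] at hk
  have hpos : 0 < Module.finrank H ((I.map ι0).comap (lc w)) := by omega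
  obtain ⟨⟨x, hx⟩, hx0⟩ := Module.finrank_pos_iff_exists_ne_zero.1 hpos
  have hx0' : x ≠ 0 := fun h => hx0 (Subtype.ext h)
  obtain ⟨p, hpI, hp⟩ := hx
  have hpl : pl (lc w x) = p := by rw [← hp]; rfl
  have hpr : lc w x (Sum.inr ()) = 0 := by rw [← hp]; rfl
  have hp0 : p ≠ 0 := by
    intro h; rw [h, map_zero] at hp
    exact hx0' (hw x hp.symm)
  by_contra hcon
  have hbl : ∀ y, bl π p (pl (lc w y)) = 0 := by
    intro y
    by_contra hne
    apply hcon
    refine ⟨x, y, ?_, ?_⟩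
    · rw [ev_pb, ev_QQ, hpl, hpr, hI0 p hpI]; ring
    · rw [bl_pb, bl_QQ h2, hpl]; exact hne
  let T : ((Fin i → H) × H) →ₗ[H] Module.Dual H (κ ⊕ Unit → H) :=
    LinearMap.mk₂ H (fun cd y => bl π (lc u cd.1 + cd.2 • p) (pl y) - (cd.1 ⬝ᵥ β) * y (Sum.inr ()))
      (by
        intro a b y
        simp only [Prod.fst_add, Prod.snd_add, map_add, add_smul, bl_add_left, add_dotProduct]; ring)
      (by
        intro c a y
        simp only [Prod.smul_fst, Prod.smul_snd, map_smul, smul_dotProduct, bl_add_left, bl_smul_left,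
          smul_eq_mul]; ring)
      (by
        intro a y y'
        simp only [map_add, bl_add_right, Pi.add_apply]; ring)
      (by
        intro c a y
        simp only [map_smul, bl_smul_right, Pi.smul_apply, smul_eq_mul]; ring)
  have hT : ∀ cd y, T cd y = bl π (lc u cd.1 + cd.2 • p) (pl y) - (cd.1 ⬝ᵥ β) * y (Sum.inr ()) :=
    fun _ _ => rfl
  have hTinj : Function.Injective T := by
    rw [← LinearMap.ker_eq_bot, LinearMap.ker_eq_bot']
    rintro ⟨c, d'⟩ hcd
    have h1 : lc u c + d' • p = 0 := by
      apply hnd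
      intro y
      have := LinearMap.congr_fun hcd (Sum.elim y 0)
      rw [hT] at this
      simpa [pl_elim] using this
    have h3 : ev π (lc u c) = 0 := by
      have : lc u c = (-d') • p := by rw [neg_smul]; exact eq_neg_of_add_eq_zero_left h1
      rw [this, ev_smul, hI0 p hpI, mul_zero]
    rw [huv] at h3
    have h4 : c = 0 := hv c (hφ _ h3)
    rw [h4, map_zero, zero_add] at h1
    have h5 : d' = 0 := (smul_eq_zero.1 h1).resolve_right hp0
    rw [h4, h5]; rfl
  have hTr : LinearMap.range T ≤ (LinearMap.range (lc w)).dualAnnihilator := by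
    rintro _ ⟨cd, rfl⟩
    rw [Submodule.mem_dualAnnihilator]
    rintro _ ⟨y, rfl⟩
    rw [hT, bl_add_left, bl_smul_left, hbl y]
    rw [rel_lc2 π u (pl (lc w y)) (lc w y (Sum.inr ())) β (fun l => rel_lc π w (u l) (β l) (hrel l) y)]
    ring
  have e1 := Submodule.finrank_mono hTr
  rw [LinearMap.finrank_range_of_inj hTinj] at e1
  have e2 := Subspace.finrank_add_finrank_dualAnnihilator_eq (LinearMap.range (lc w))
  have e3 : Module.finrank H (LinearMap.range (lc w)) = N := by
    rw [LinearMap.finrank_range_of_inj, Module.finrank_fintype_fun_eq_card, Fintype.card_fin]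
    rw [← LinearMap.ker_eq_bot, LinearMap.ker_eq_bot']; exact hw
  rw [Module.finrank_fintype_fun_eq_card, Fintype.card_sum, Fintype.card_unit] at e2
  rw [Module.finrank_prod, Module.finrank_fintype_fun_eq_card, Fintype.card_fin,
    Module.finrank_self] at e1
  omega

lemma contra_H {H : Type} [Field H] (h2 : (2 : H) = 0) {μ : Type} [Fintype μ]
    (π : Matrix κ κ H) (hnd : Nd π) (φ : Matrix μ μ H) (hφ : An φ) (d : ℕ)
    (hcard : Fintype.card κ = 2 * d) (I : Submodule H (κ → H)) (hI : Module.finrank H I = d)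
    (hI0 : ∀ x ∈ I, ev π x = 0) (i N : ℕ)
    (u : Fin i → κ → H) (v : Fin i → μ → H) (vi : μ → H)
    (hv : ∀ (t : H) c, t • vi + lc v c = 0 → t = 0 ∧ c = 0)
    (huv : ∀ c, ev π (lc u c) = ev φ (lc v c))
    (w : Fin N → κ ⊕ Unit → H) (hN : 2 * d + 1 ≤ N + i) (hw : LI w)
    (hrel : ∀ l a, bl π (u l) (pl (w a)) = w a (Sum.inr ()) * bl φ (v l) vi)
    (U : Fin N → κ → H) (c0 : H) (hc0 : c0 ≠ 0)
    (hU : ∀ x, ev π (lc U x) = c0 * ev (pb (QQ π (ev φ vi)) w) x) : False := by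
  let W := I.comap (lc U)
  have hk := ker_dim (lc U) I
  rw [hI, Module.finrank_fintype_fun_eq_card, Module.finrank_fintype_fun_eq_card,
    Fintype.card_fin] at hk
  let a : (W × (Fin i → H)) →ₗ[H] (κ → H) :=
    ((pl.comp ((lc w).comp W.subtype)).comp (LinearMap.fst H _ _)) + (lc u).comp (LinearMap.snd H _ _)
  let b : (W × (Fin i → H)) →ₗ[H] (μ → H) :=
    ((LinearMap.proj (Sum.inr ()) : (κ ⊕ Unit → H) →ₗ[H] H).comp
      ((lc w).comp (W.subtype.comp (LinearMap.fst H _ _)))).smulRight vi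
      + (lc v).comp (LinearMap.snd H _ _)
  have ha : ∀ s, a s = pl (lc w s.1) + lc u s.2 := fun _ => rfl
  have hb : ∀ s, b s = lc w s.1 (Sum.inr ()) • vi + lc v s.2 := fun _ => rfl
  have hle := bound (S := W × (Fin i → H)) h2 π hnd φ hφ d hcard I hI hI0 a b ?_ ?_
  · rw [Module.finrank_prod, Module.finrank_fintype_fun_eq_card, Fintype.card_fin] at hle
    change Module.finrank H W + i ≤ d at hle
    change _ ≤ Module.finrank H W + _ at hk
    omega
  · rintro ⟨⟨x, hx⟩, c⟩
    rw [ha, hb]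
    simp only
    have h1 : ev (pb (QQ π (ev φ vi)) w) x = 0 := by
      have := hU x
      rw [hI0 _ hx] at this
      exact (mul_eq_zero.1 this.symm).resolve_left hc0
    rw [ev_pb, ev_QQ] at h1
    have h3 := rel_lc2 π u (pl (lc w x)) (lc w x (Sum.inr ())) (fun l => bl φ (v l) vi)
      (fun l => rel_lc π w (u l) _ (hrel l) x) c
    have h4 := rel_lc2 φ v vi 1 (fun l => bl φ (v l) vi) (fun l => by ring) c
    rw [ev_add, ev_add, ev_smul, bl_smul_left, huv, bl_comm π, bl_comm φ vi, h3, h4]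
    linear_combination h1 - (ev φ vi * lc w x (Sum.inr ()) ^ 2) * h2
  · rintro ⟨⟨x, hx⟩, c⟩ h1 h3
    rw [ha] at h1
    rw [hb] at h3
    simp only at h1 h3
    obtain ⟨h4, h5⟩ := hv _ _ h3
    rw [h5, map_zero, add_zero] at h1
    have h6 : lc w x = 0 := by
      funext k
      rcases k with k | k
      · exact congrFun h1 k
      · exact h4
    have h7 := hw x h6
    subst h7
    rw [h5]; rfl

end stepA
end HS

namespace HS
open Matrix

section main
variable {F : Type} [Field F] {M : ℕ}

lemma comp_map {ι A B C : Type} [CommRing A] [CommRing B] [CommRing C] (f : A →+* B)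
    (g : B →+* C) (q : Matrix ι ι A) : (q.map f).map g = q.map (g.comp f) := by
  rw [Matrix.map_map]; rfl

lemma sta_extend (h2 : (2 : F) = 0) (φ : Matrix (Fin M) (Fin M) F) (v : ℕ → Fin M → F) (n i : ℕ)
    (E : Type) [Field E] (jF : F →+* E) (X : ℕ → E) (D : E) (u : ℕ → PI n → E)
    (hX : ∀ l < n, X l ≠ 0)
    (hev : ∀ l < i, ev (pm X D n) (u l) = jF (ev φ (v l)))
    (hbl : ∀ l < i, ∀ k < i, bl (pm X D n) (u l) (u k) = jF (bl φ (v l) (v k)))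
    (E' H' : Type) [Field E'] [Field H'] (f : E →+* E') (g : E' →+* H')
    (hiso : ¬ An ((pm X D n).map (g.comp f))) (hφ : An (φ.map ((g.comp f).comp jF)))
    (han : An ((pm X D n).map f)) (p : PI n → E') (t : E') (hpt : p ≠ 0 ∨ t ≠ 0)
    (h0 : ev ((pm X D n).map f) p + f (jF (ev φ (v i))) * t ^ 2 = 0)
    (hrel : ∀ l < i, bl ((pm X D n).map f) (fun j => f (u l j)) p = t * f (jF (bl φ (v l) (v i)))) :
    Nonempty (Sta φ v n (i + 1)) := by
  have ht : t ≠ 0 := by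
    intro ht
    rw [ht] at h0
    have : p = 0 := han p (by linear_combination h0)
    rcases hpt with h | h
    · exact h this
    · exact h ht
  have h2' : (2 : E') = 0 := two_map (f.comp jF) h2
  let u' : ℕ → PI n → E' := fun l => if l < i then (fun j => f (u l j)) else t⁻¹ • p
  have hu1 : ∀ l < i, u' l = fun j => f (u l j) := fun l hl => if_pos hl
  have hu2 : u' i = t⁻¹ • p := if_neg (lt_irrefl i)
  have hmap := pm_map f X D n
  refine ⟨{ E := E', H := H', jF := f.comp jF, jH := g, X := fun l => f (X l), D := f D, u := u',
            hX := fun l hl => by simpa using hX l hl,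
            anE := hmap ▸ han, isH := by rw [← hmap, comp_map]; exact hiso,
            anφ := hφ, hev := ?_, hbl := ?_ }⟩
  · intro l hl
    rw [← hmap]
    rcases Nat.lt_succ_iff_lt_or_eq.1 hl with h | h
    · rw [hu1 l h, ev_map, hev l h]; rfl
    · subst h
      rw [hu2, ev_smul]
      have : ev ((pm X D n).map f) p = f (jF (ev φ (v l))) * t ^ 2 := by
        linear_combination h0 - (f (jF (ev φ (v l))) * t ^ 2) * h2'
      rw [this]
      simp only [RingHom.comp_apply]
      field_simp
  · intro l hl k hk
    rw [← hmap]
    rcases Nat.lt_succ_iff_lt_or_eq.1 hl with h | h <;> rcases Nat.lt_succ_iff_lt_or_eq.1 hk with h' | h'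
    · rw [hu1 l h, hu1 k h', bl_map, hbl l h k h']; rfl
    · subst h'
      rw [hu1 l h, hu2, bl_smul_right, hrel l h]
      simp only [RingHom.comp_apply]
      field_simp
    · subst h
      rw [hu1 k h', hu2, bl_smul_left, bl_comm, hrel k h', bl_comm φ]
      simp only [RingHom.comp_apply]
      field_simp
    · subst h; subst h'
      rw [bl_self, bl_self, map_mul, h2', map_ofNat, h2', zero_mul, zero_mul]

lemma sta_step (h2 : (2 : F) = 0) (φ : Matrix (Fin M) (Fin M) F) (v : ℕ → Fin M → F) (n i : ℕ)
    (hi : i < 2 ^ n)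
    (hv : LI (fun l : Fin (i + 1) => v l)) (S : Sta φ v n i) : Nonempty (Sta φ v n (i + 1)) := by
  obtain ⟨E, H, jF, jH, X, D, u, hX, anE, isH, anφ, hev, hbl⟩ := S
  rename_i fE fH
  have h2E : (2 : E) = 0 := two_map jF h2
  have h2H : (2 : H) = 0 := two_map jH h2E
  obtain ⟨N, w, hN, hw, hrel⟩ := exists_w (pm X D n) i (fun l => u l)
    (fun l => jF (bl φ (v l) (v i)))
  rw [card_PI] at hN
  set α := jF (ev φ (v i)) with hα
  set γ := pb (QQ (pm X D n) α) w with hγ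
  have hγmap : ∀ {K : Type} [Field K] (f : E →+* K),
      γ.map f = pb (QQ ((pm X D n).map f) (f α)) (fun a j => f (w a j)) := by
    intro K _ f
    rw [hγ, pb_map, QQ_map]
  have hrelf : ∀ {K : Type} [Field K] (f : E →+* K) (l : Fin i) (a : Fin N),
      bl ((pm X D n).map f) (fun j => f (u l j)) (pl (fun j => f (w a j))) =
        f (w a (Sum.inr ())) * f (jF (bl φ (v l) (v i))) := by
    intro K _ f l a
    rw [← map_mul, ← hrel l a, ← bl_map]; rfl
  -- extension step
  have hext : ∀ (E' H' : Type) [Field E'] [Field H'] (f : E →+* E') (g : E' →+* H')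
      (hiso : ¬ An ((pm X D n).map (g.comp f))) (hφ : An (φ.map ((g.comp f).comp jF)))
      (han : An ((pm X D n).map f)) (hγ0 : ¬ An (γ.map f)), Nonempty (Sta φ v n (i + 1)) := by
    intro E' H' _ _ f g hiso hφ han hγ0
    obtain ⟨x, hx0, hx⟩ := an_iff_of_iso_not.1 hγ0
    rw [hγmap f, ev_pb, ev_QQ] at hx
    refine sta_extend h2 φ v n i E jF X D u hX hev hbl E' H' f g hiso hφ han
      (pl (lc (fun a j => f (w a j)) x)) (lc (fun a j => f (w a j)) x (Sum.inr ())) ?_ hx ?_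
    · by_contra hcon
      push Not at hcon
      apply hx0
      apply li_map f w hw
      funext k
      rcases k with k | k
      · exact congrFun hcon.1 k
      · exact hcon.2
    · intro l hl
      exact rel_lc ((pm X D n).map f) (fun a j => f (w a j)) (fun j => f (u l j))
        (f (jF (bl φ (v l) (v i)))) (hrelf f ⟨l, hl⟩) x
  by_cases hγA : An γ
  swap
  · refine hext E H (RingHom.id E) jH ?_ ?_ ?_ ?_
    · rwa [RingHom.comp_id]
    · rwa [RingHom.comp_id]
    · simpa using anE
    · simpa using hγA
  -- over H
  have hpmH := pm_map jH X D n
  have hXH : ∀ l < n, jH (X l) ≠ 0 := fun l hl => by simpa using hX l hl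
  have ndH : Nd ((pm X D n).map jH) := by
    rw [hpmH]; exact nd_pm h2H _ _ n hXH
  obtain ⟨I, hI, hI0⟩ := tot_iso h2H (fun l => jH (X l)) (jH D) n hXH (by rw [← hpmH]; exact isH)
  rw [← hpmH] at hI0
  have hcardPI : Fintype.card (PI n) = 2 * 2 ^ n := by rw [card_PI]; ring
  let vH : Fin i → Fin M → H := fun l j => jH (jF (v l j))
  let uH : Fin i → PI n → H := fun l j => jH (u l j)
  let wH : Fin N → PI n ⊕ Unit → H := fun a j => jH (w a j)
  let viH : Fin M → H := fun j => jH (jF (v i j))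
  have hvH : ∀ (t : H) c, t • viH + lc vH c = 0 → t = 0 ∧ c = 0 := by
    intro t c htc
    have h1 := li_map (jH.comp jF) _ hv (Fin.snoc (α := fun _ => H) c t) (by
      rw [lc_apply, Fin.sum_univ_castSucc]
      simp only [Fin.snoc_castSucc, Fin.snoc_last]
      rw [add_comm]
      rw [lc_apply] at htc
      exact htc)
    constructor
    · have := congrFun h1 (Fin.last i); simpa using this
    · funext l
      have := congrFun h1 (Fin.castSucc l); simpa using this
  have hvH' : LI vH := by
    intro c hc
    exact (hvH 0 c (by rw [hc]; simp)).2
  have huvH : ∀ c, ev ((pm X D n).map jH) (lc uH c) = ev (φ.map (jH.comp jF)) (lc vH c) := by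
    intro c
    rw [lc_apply, lc_apply, ← one_mul (ev (φ.map _) _)]
    apply gram_ev
    · intro l _
      rw [one_mul]
      refine (ev_map jH _ _).trans ?_
      rw [hev l l.2]
      exact (ev_map (jH.comp jF) φ (v l)).symm
    · intro l _ k _
      rw [one_mul]
      refine (bl_map jH _ _ _).trans ?_
      rw [hbl l l.2 k k.2]
      exact (bl_map (jH.comp jF) φ (v l) (v k)).symm
  have hwH : LI wH := li_map jH w hw
  have hblv : ∀ l : Fin i, bl (φ.map (jH.comp jF)) (vH l) viH = jH (jF (bl φ (v l) (v i))) := fun l =>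
    bl_map (jH.comp jF) φ (v l) (v i)
  have hevv : ev (φ.map (jH.comp jF)) viH = jH α := ev_map (jH.comp jF) φ (v i)
  have hrelH : ∀ l a, bl ((pm X D n).map jH) (uH l) (pl (wH a)) = wH a (Sum.inr ()) *
      bl (φ.map (jH.comp jF)) (vH l) viH := by
    intro l a
    rw [hblv]
    exact hrelf jH l a
  have hNd : 2 * 2 ^ n + 1 ≤ N + i := by rw [← hcardPI, card_PI]; exact hN
  have hnriH : NRI (γ.map jH) := by
    rw [hγmap jH]
    exact nri_H h2H _ ndH _ anφ (2 ^ n) hcardPI I hI hI0 i N hi uH _ vH hvH' huvH wH hNd hwH hrelH (jH α)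
  -- choose z, e
  obtain ⟨z, e, hz⟩ : ∃ z e, bl γ z e ≠ 0 := by
    by_contra hcon
    push Not at hcon
    obtain ⟨y, z, _, hyz⟩ := hnriH
    apply hyz
    rw [bl_eq_sum]
    classical
    have hentry : ∀ a b, γ a b + γ b a = 0 := by
      intro a b
      have := hcon (Pi.single a 1) (Pi.single b 1)
      simpa [bl] using this
    have h3 : ∀ a b, jH (γ a b) + jH (γ b a) = 0 := by
      intro a b; rw [← map_add, hentry, map_zero]
    have h4 : ∑ a, ∑ b, (γ.map jH) a b * (y a * z b + z a * y b)
        = ∑ a, ∑ b, (jH (γ a b) + jH (γ b a)) * (y a * z b) := by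
      have e1 : ∑ a, ∑ b, jH (γ a b) * (z a * y b) = ∑ a, ∑ b, jH (γ b a) * (y a * z b) := by
        rw [Finset.sum_comm]
        refine Finset.sum_congr rfl fun a _ => Finset.sum_congr rfl fun b _ => by ring
      simp only [map_apply, mul_add, add_mul, Finset.sum_add_distrib]
      rw [e1]
    rw [h4]
    refine Finset.sum_eq_zero fun a _ => Finset.sum_eq_zero fun b _ => by rw [h3, zero_mul]
  have hc : ev γ e ≠ 0 := by
    intro h
    rw [hγA e h, bl_zero_right] at hz
    exact hz rfl
  haveI : Fact (Irreducible (gpol γ e)) := ⟨gpol_irred h2E γ hγA z e hz hc⟩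
  by_cases hE' : An ((pm X D n).map (cG γ e))
  · obtain ⟨g, hg⟩ := GF_univ h2E γ z e hz hc H jH hnriH
    refine hext (GFd γ e) (GR (N + 1) H) (cG γ e) g ?_ ?_ hE' ?_
    · rw [hg, ← comp_map]
      exact not_an_map _ isH
    · rw [hg]
      have := an_GR (N + 1) _ anφ
      rw [comp_map] at this
      exact this
    · obtain ⟨y, z', hy, hyz⟩ := GF_nri h2E γ z e hz
      rw [an_iff_of_iso_not]
      refine ⟨y, ?_, hy⟩
      rintro rfl
      exact hyz (bl_zero_left _ _)
  · exfalso
    have HL : ∀ (K : Type) [Field K] (f : E →+* K), NRI (γ.map f) → ¬ An ((pm X D n).map f) := by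
      intro K _ f hf hA
      obtain ⟨g, hg⟩ := GF_univ h2E γ z e hz hc K f hf
      have h1 := an_GR (N + 1) _ hA
      rw [comp_map, ← hg, ← comp_map] at h1
      exact not_an_map g hE' h1
    obtain ⟨U, hU⟩ := dom h2E (pm X D n) anE γ (ev γ e)
      (L6 h2E X D n hX γ z e hz hc HL)
    refine contra_H h2H ((pm X D n).map jH) ndH _ anφ (2 ^ n) hcardPI I hI hI0 i N uH vH viH hvH huvH
      wH hNd hwH hrelH (fun a j => jH (U a j)) (jH (ev γ e)) (by simpa using hc) ?_
    intro x
    rw [lc_apply, hU H jH x, hγmap jH, hevv]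

lemma sta_all (h2 : (2 : F) = 0) (φ : Matrix (Fin M) (Fin M) F) (hφ : An φ) (v : ℕ → Fin M → F)
    (n a : ℕ) (ha : a ≤ 2 ^ n) (hv : LI (fun l : Fin a => v l)) :
    ∀ i ≤ a, Nonempty (Sta φ v n i) := by
  intro i
  induction i with
  | zero => intro _; exact sta_base φ hφ v n
  | succ i ih =>
    intro hi
    obtain ⟨S⟩ := ih (by omega)
    refine sta_step h2 φ v n i (by omega) ?_ S
    intro x hx
    have h1 := hv (fun l => if h : l.1 < i + 1 then x ⟨l, h⟩ else 0) ?_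
    · funext l
      have := congrFun h1 ⟨l.1, by omega⟩
      simp only [l.2, dite_true, Pi.zero_apply] at this
      exact this
    · rw [lc_apply] at hx ⊢
      rw [← hx]
      symm
      refine Finset.sum_of_injOn (fun l : Fin (i+1) => (⟨l.1, by omega⟩ : Fin a)) ?_ ?_ ?_ ?_
      · intro a _ b _ h; simpa [Fin.ext_iff] using h
      · intro a _; simp
      · intro b _ hb
        have : ¬ b.1 < i + 1 := by
          intro h
          apply hb
          exact ⟨⟨b.1, h⟩, by simp, rfl⟩
        simp [this]
      · intro l _
        simp only [l.2, dite_true]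

theorem final (h2 : (2 : F) = 0) (φ : Matrix (Fin M) (Fin M) F) (hφ : An φ) (v : ℕ → Fin M → F)
    (n a : ℕ) (ha : a ≤ 2 ^ n) (hM : 2 ^ n < M) (hv : LI (fun l : Fin a => v l))
    (z e : Fin M → F) (hz : bl φ z e ≠ 0)
    (Hα : ∀ (K : Type) [Field K] (f : F →+* K), NRI (φ.map f) →
      ∃ c : Fin a → K, c ≠ 0 ∧ ev (φ.map f) (lc (fun (l : Fin a) j => f (v l j)) c) = 0) : False := by
  obtain ⟨S⟩ := sta_all h2 φ hφ v n a ha hv a le_rfl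
  obtain ⟨E, H, jF, jH, X, D, u, hX, anE, isH, anφ, hev, hbl⟩ := S
  rename_i fE fH
  have h2E : (2 : E) = 0 := two_map jF h2
  have h2H : (2 : H) = 0 := two_map jH h2E
  have hpmH := pm_map jH X D n
  have hXH : ∀ l < n, jH (X l) ≠ 0 := fun l hl => by simpa using hX l hl
  obtain ⟨I, hI, hI0⟩ := tot_iso h2H (fun l => jH (X l)) (jH D) n hXH (by rw [← hpmH]; exact isH)
  rw [← hpmH] at hI0
  have anφE : An (φ.map jF) := by
    apply an_of_map jH
    rw [comp_map]; exact anφ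
  have huv : ∀ (K : Type) [Field K] (f : E →+* K) c,
      ev ((pm X D n).map f) (lc (fun (l : Fin a) j => f (u l j)) c) =
        ev (φ.map (f.comp jF)) (lc (fun (l : Fin a) j => f (jF (v l j))) c) := by
    intro K _ f c
    rw [lc_apply, lc_apply, ← one_mul (ev (φ.map _) _)]
    apply gram_ev
    · intro l _
      rw [one_mul]
      refine (ev_map f _ _).trans ?_
      rw [hev l l.2]
      exact (ev_map (f.comp jF) φ (v l)).symm
    · intro l _ k _
      rw [one_mul]
      refine (bl_map f _ _ _).trans ?_
      rw [hbl l l.2 k k.2]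
      exact (bl_map (f.comp jF) φ (v l) (v k)).symm
  have hu : LI (fun l : Fin a => u l) := by
    intro c hc
    have h1 := huv E (RingHom.id E) c
    simp only [RingHom.id_apply] at h1
    rw [hc, ev_zero] at h1
    exact li_map jF _ hv c (anφE _ h1.symm)
  have hz' : bl (φ.map jF) (fun j => jF (z j)) (fun j => jF (e j)) ≠ 0 := by
    rw [bl_map]; simpa using hz
  have hc : ev (φ.map jF) (fun j => jF (e j)) ≠ 0 := by
    intro h
    have := anφE _ h
    rw [this, bl_zero_right] at hz'
    exact hz' rfl
  have HL : ∀ (K : Type) [Field K] (f : E →+* K), NRI ((φ.map jF).map f) → ¬ An ((pm X D n).map f) := by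
    intro K _ f hf
    rw [comp_map] at hf
    obtain ⟨c, hc0, hc⟩ := Hα K (f.comp jF) hf
    rw [an_iff_of_iso_not]
    refine ⟨lc (fun (l : Fin a) j => f (u l j)) c, fun h => hc0 (li_map f _ hu c h), ?_⟩
    rw [huv]; exact hc
  obtain ⟨U, hU⟩ := dom h2E (pm X D n) anE (φ.map jF) _ (L6 h2E X D n hX _ _ _ hz' hc HL)
  have hk := ker_dim (lc (fun a j => jH (U a j))) I
  rw [hI, Module.finrank_fintype_fun_eq_card, Module.finrank_fintype_fun_eq_card,
    Fintype.card_fin, card_PI] at hk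
  have hpos : 0 < Module.finrank H (I.comap (lc (fun a j => jH (U a j)))) := by
    have : 2 ^ (n + 1) = 2 * 2 ^ n := by ring
    omega
  obtain ⟨⟨x, hx⟩, hx0⟩ := Module.finrank_pos_iff_exists_ne_zero.1 hpos
  apply hx0
  have h3 := hU H jH x
  rw [← lc_apply, hI0 _ hx, comp_map] at h3
  have h4 := (mul_eq_zero.1 h3.symm).resolve_left (by simpa using hc)
  exact Subtype.ext (anφ x h4)

end main
end HS

namespace HS
open Matrix

lemma sep_red (R K L : Type) [Field R] [Field K] [Algebra R K] [Algebra.IsSeparable R K]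
    [Field L] [Algebra R L] : IsReduced (L ⊗[R] K) := by
  refine IsReduced.tensorProduct_of_flat_of_forall_fg fun B hB => ?_
  let _ : Field B := (Subalgebra.isField_of_algebraic B).toField
  have : Algebra.FiniteType R B := (Subalgebra.fg_iff_finiteType B).1 hB
  have : Algebra.IsSeparable R B := Algebra.IsSeparable.of_algHom R K B.val
  have : Algebra.FormallyUnramified R B := Algebra.FormallyUnramified.of_isSeparable R B
  exact Algebra.FormallyUnramified.isReduced_of_field L (L ⊗[R] B)

lemma red_equiv {A B : Type} [CommRing A] [CommRing B] (e : A ≃+* B) (h : IsReduced A) :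
    IsReduced B := isReduced_of_injective e.symm e.symm.injective

/-- `K ⊗ L` reduced for all purely inseparable `L` -/
def SE (F : Type) [Field F] (K : Type) [Field K] [Algebra F K] : Prop :=
  ∀ (L : Type) [Field L] [Algebra F L], IsPurelyInseparable F L → IsReduced (K ⊗[F] L)

lemma se_sep (F K : Type) [Field F] [Field K] [Algebra F K] [Algebra.IsSeparable F K] : SE F K := by
  intro L _ _ _
  exact red_equiv (Algebra.TensorProduct.comm F L K).toRingEquiv (sep_red F K L)

lemma dom_GR (N : ℕ) (F L : Type) [Field F] [Field L] [Algebra F L] :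
    IsDomain (GR N F ⊗[F] L) := by
  let A := MvPolynomial (Fin N) F
  let B := GR N F
  have hd : IsDomain (A ⊗[F] L) := by
    have e : (L ⊗[F] A) ≃+* MvPolynomial (Fin N) L :=
      (MvPolynomial.algebraTensorAlgEquiv F L).toRingEquiv
    exact ((Algebra.TensorProduct.comm F A L).toRingEquiv.trans e).toMulEquiv.isDomain _
  let φ : A ⊗[F] L →ₐ[A] B ⊗[F] L :=
    Algebra.TensorProduct.map (Algebra.ofId A B) (AlgHom.id F L)
  let _ : Algebra (A ⊗[F] L) (B ⊗[F] L) := φ.toRingHom.toAlgebra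
  have : IsScalarTower A (A ⊗[F] L) (B ⊗[F] L) := IsScalarTower.of_algebraMap_eq' (by
    exact φ.comp_algebraMap.symm)
  have hl := IsLocalization.tensorProduct_tensorProduct F L (nonZeroDivisors A) B (by
    ext x
    change φ (1 ⊗ₜ x) = 1 ⊗ₜ x
    simp [φ])
  refine IsLocalization.isDomain_of_le_nonZeroDivisors (B ⊗[F] L)
    (M := Algebra.algebraMapSubmonoid (A ⊗[F] L) (nonZeroDivisors A)) ?_
  rintro _ ⟨a, ha, rfl⟩
  refine mem_nonZeroDivisors_of_ne_zero ?_
  intro h0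
  have : Function.Injective (algebraMap A (A ⊗[F] L)) := by
    exact Algebra.TensorProduct.includeLeft_injective (S := F) (RingHom.injective _)
  exact nonZeroDivisors.ne_zero ha (this (h0.trans (map_zero _).symm))

lemma se_tower (N : ℕ) (F K : Type) [Field F] [Field K] [Algebra F K] [Algebra (GR N F) K]
    [IsScalarTower F (GR N F) K] [Algebra.IsSeparable (GR N F) K] : SE F K := by
  intro L _ _ hL
  have := dom_GR N F L
  have : Algebra.IsAlgebraic F L := inferInstance
  let _ : Field (GR N F ⊗[F] L) :=
    (Algebra.TensorProduct.isField_of_isAlgebraic F (GR N F) L (Or.inr this)).toField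
  have h := sep_red (GR N F) K (GR N F ⊗[F] L)
  exact red_equiv (((Algebra.TensorProduct.comm (GR N F) _ K).toRingEquiv).trans
    (Algebra.TensorProduct.cancelBaseChange F (GR N F) (GR N F) K L).toRingEquiv) h

lemma gpol_sep {F : Type} [Field F] {N : ℕ} (h2 : (2 : F) = 0) (γ : Matrix (Fin N) (Fin N) F)
    (z e : Fin N → F) (hz : bl γ z e ≠ 0) [hi : Fact (Irreducible (gpol γ e))] :
    Algebra.IsSeparable (GR N F) (GFd γ e) := by
  have hs : (gpol γ e).Separable := by
    rw [Polynomial.separable_iff_derivative_ne_zero hi.out]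
    have h2' : (2 : GR N F) = 0 := two_map (cR N F) h2
    have h : (gpol γ e).derivative = Polynomial.C (algebraMap _ (GR N F) (blP γ e)) := by
      unfold gpol
      simp only [Polynomial.derivative_add, Polynomial.derivative_mul, Polynomial.derivative_C,
        Polynomial.derivative_X_pow, Polynomial.derivative_X]
      simp [h2']
    rw [h]
    exact fun h0 => alg_ne (blP_ne γ z e hz) (Polynomial.C_eq_zero.1 h0)
  have hr : AdjoinRoot.root (gpol γ e) ∈ separableClosure (GR N F) (GFd γ e) := by
    rw [mem_separableClosure_iff]
    refine hs.of_dvd (minpoly.dvd _ _ ?_)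
    exact AdjoinRoot.eval₂_root (gpol γ e)
  refine ⟨fun x => ?_⟩
  rw [← mem_separableClosure_iff]
  induction x using AdjoinRoot.induction_on with
  | ih p =>
    have : AdjoinRoot.mk (gpol γ e) p = Polynomial.aeval (AdjoinRoot.root (gpol γ e)) p :=
      (AdjoinRoot.aeval_eq p).symm
    rw [this]
    exact (Algebra.adjoin_le (S := (separableClosure (GR N F) (GFd γ e)).toSubalgebra) (Set.singleton_subset_iff.2 hr)) (Polynomial.aeval_mem_adjoin_singleton _ _)

lemma se_GF {F : Type} [Field F] {N : ℕ} (h2 : (2 : F) = 0) (γ : Matrix (Fin N) (Fin N) F)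
    (z e : Fin N → F) (hz : bl γ z e ≠ 0) [hi : Fact (Irreducible (gpol γ e))] :
    SE F (GFd γ e) := by
  have := gpol_sep h2 γ z e hz
  exact se_tower N F (GFd γ e)

lemma algMap_GF {F : Type} [Field F] {N : ℕ} (γ : Matrix (Fin N) (Fin N) F)
    (e : Fin N → F) : algebraMap F (GFd γ e) = cG γ e := by
  rfl

end HS

namespace HS
open Matrix

section bridge
variable {F : Type} [Field F]

lemma eval_eq {n : ℕ} (q : QF F n) (x : Fin n → F) : QF.eval q x = ev q x := by
  rw [ev_eq_sum]
  simp only [QF.eval, mul_assoc]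

lemma eval_orth {n m : ℕ} (q : QF F n) (q' : QF F m) (x : Fin n → F) (y : Fin m → F) :
    ev (QF.orthSum q q') (Fin.append x y) = ev q x + ev q' y := by
  simp [ev_eq_sum, QF.orthSum, Fin.sum_univ_add]

lemma eval_bin {r : ℕ} (a b : Fin r → F) (x y : Fin r → F) :
    ev (QF.binSum a b) (Fin.append x y) =
      ∑ i, (a i * x i ^ 2 + x i * y i + b i * y i ^ 2) := by
  simp only [ev_eq_sum, QF.binSum, Fin.sum_univ_add]
  simp [-Fin.natAdd_eq_addNat, Matrix.diagonal_apply, Matrix.one_apply, Finset.sum_add_distrib, pow_two]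

lemma eval_hyper {w : ℕ} (x y : Fin w → F) :
    ev (QF.hyper w : QF F (w+w)) (Fin.append x y) = ∑ i, x i * y i := by
  rw [QF.hyper, eval_bin]; simp

lemma append_split {n m : ℕ} (x : Fin (n+m) → F) : ∃ y z, x = Fin.append y z :=
  ⟨_, _, (Fin.append_castAdd_natAdd (f := x)).symm⟩

lemma lc_append {n m k : ℕ} (u : Fin n → Fin k → F) (v : Fin m → Fin k → F) (x : Fin n → F)
    (y : Fin m → F) : lc (Fin.append u v) (Fin.append x y) = lc u x + lc v y := by
  simp [lc_apply, Fin.sum_univ_add]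

lemma bl_lc {n k : ℕ} (q : QF F k) (u : Fin n → Fin k → F) (x : Fin n → F) (z : Fin k → F) :
    bl q (lc u x) z = ∑ i, x i * bl q (u i) z := by
  have := congrArg (fun t => blm q t z) (lc_apply u x)
  simpa [map_sum, LinearMap.sum_apply, bl_smul_left] using this

lemma ev_lc0 {n k : ℕ} (q : QF F k) (u : Fin n → Fin k → F) (x : Fin n → F)
    (h : ∀ i, ev q (u i) = 0) (h' : ∀ i j, bl q (u i) (u j) = 0) : ev q (lc u x) = 0 := by
  rw [lc_apply]
  have : ∀ s : Finset (Fin n), ev q (∑ i ∈ s, x i • u i) = 0 := by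
    intro s
    induction s using Finset.induction_on with
    | empty => simp [ev_zero]
    | insert a s ha ih =>
      rw [Finset.sum_insert ha, ev_add, ih, ev_smul, h, mul_zero, zero_add, zero_add]
      have h3 : ∀ z, bl q z (∑ i ∈ s, x i • u i) = ∑ i ∈ s, x i * bl q z (u i) := by
        intro z
        have : blm q z (∑ i ∈ s, x i • u i) = ∑ i ∈ s, x i * bl q z (u i) := by
          rw [map_sum]; simp [bl_smul_right]
        exact this
      rw [h3]
      simp [bl_smul_left, h']
  exact this _

/-- the set defining the Witt index -/
def WS {n : ℕ} (q : QF F n) : Set ℕ := {w | ∃ (m : ℕ) (q' : QF F m), QF.Isom q (QF.orthSum q' (QF.hyper w))}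

lemma hb_mem {k w : ℕ} (q : QF F k) (u v : Fin w → Fin k → F)
    (hu : ∀ i, ev q (u i) = 0) (hv : ∀ i, ev q (v i) = 0)
    (huu : ∀ i j, bl q (u i) (u j) = 0) (hvv : ∀ i j, bl q (v i) (v j) = 0)
    (huv : ∀ i j, bl q (u i) (v j) = if i = j then 1 else 0) : w ∈ WS q := by
  let W : Submodule F (Fin k → F) :=
    { carrier := {x | ∀ i, bl q x (u i) = 0 ∧ bl q x (v i) = 0}
      add_mem' := by
        intro a b ha hb i
        rw [bl_add_left, bl_add_left, (ha i).1, (ha i).2, (hb i).1, (hb i).2]; simp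
      zero_mem' := by intro i; simp [bl_zero_left]
      smul_mem' := by
        intro c a ha i
        rw [bl_smul_left, bl_smul_left, (ha i).1, (ha i).2]; simp }
  let B := Module.finBasis F W
  let b : Fin (Module.finrank F W) → Fin k → F := fun i => (B i : Fin k → F)
  have hb : ∀ x, lc b x = ((∑ i, x i • B i : W) : Fin k → F) := by
    intro x; rw [lc_apply]; simp [b]
  have hbW : ∀ x, lc b x ∈ W := by intro x; rw [hb]; exact Subtype.property _
  have hvu : ∀ i j, bl q (v i) (u j) = if i = j then 1 else 0 := by
    intro i j; rw [bl_comm, huv]; simp [eq_comm]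
  refine ⟨Module.finrank F W, pb q b, ?_⟩
  let T := lc (Fin.append b (Fin.append u v))
  have hT : ∀ x y z, T (Fin.append x (Fin.append y z)) = lc b x + (lc u y + lc v z) := by
    intro x y z; simp only [T]; rw [lc_append, lc_append]
  have h1 : ∀ x y z j, bl q (T (Fin.append x (Fin.append y z))) (v j) = y j := by
    intro x y z j
    rw [hT, bl_add_left, bl_add_left, (hbW x j).2, bl_lc, bl_lc]
    simp [huv, hvv]
  have h2 : ∀ x y z j, bl q (T (Fin.append x (Fin.append y z))) (u j) = z j := by
    intro x y z j
    rw [hT, bl_add_left, bl_add_left, (hbW x j).1, bl_lc, bl_lc]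
    simp [hvu, huu]
  have hTb : Function.Bijective T := by
    constructor
    · rw [← LinearMap.ker_eq_bot, LinearMap.ker_eq_bot']
      intro t ht
      obtain ⟨x, t', rfl⟩ := append_split t
      obtain ⟨y, z, rfl⟩ := append_split t'
      have hy : y = 0 := by
        funext j; rw [← h1 x y z j, ht, bl_zero_left]; rfl
      have hz : z = 0 := by
        funext j; rw [← h2 x y z j, ht, bl_zero_left]; rfl
      subst hy hz
      rw [hT, map_zero, map_zero, add_zero, add_zero, hb] at ht
      have hx : x = 0 := by
        funext i
        exact (Fintype.linearIndependent_iff.1 B.linearIndependent) x (Subtype.ext ht) i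
      subst hx
      funext i
      refine Fin.addCases (fun i => ?_) (fun i => ?_) i
      · simp
      · refine Fin.addCases (fun i => ?_) (fun i => ?_) i <;> simp [-Fin.natAdd_eq_addNat]
    · intro t
      set y : Fin w → F := fun i => bl q t (v i) with hy
      set z : Fin w → F := fun i => bl q t (u i) with hz
      have hm : t - (lc u y + lc v z) ∈ W := by
        intro j
        have e1 : ∀ s, bl q (t - s) (u j) = bl q t (u j) - bl q s (u j) := by
          intro s; exact LinearMap.congr_fun (map_sub (blm q) t s) (u j)
        have e2 : ∀ s, bl q (t - s) (v j) = bl q t (v j) - bl q s (v j) := by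
          intro s; exact LinearMap.congr_fun (map_sub (blm q) t s) (v j)
        rw [e1, e2, bl_add_left, bl_add_left, bl_lc, bl_lc, bl_lc, bl_lc]
        simp [hvu, huu, huv, hvv, hy, hz]
      refine ⟨Fin.append (fun i => B.repr ⟨_, hm⟩ i) (Fin.append y z), ?_⟩
      rw [hT, hb, B.sum_repr]
      simp
  refine ⟨(LinearEquiv.ofBijective T hTb).symm, fun x => ?_⟩
  obtain ⟨t, rfl⟩ := hTb.2 x
  have : (LinearEquiv.ofBijective T hTb).symm (T t) = t :=
    (LinearEquiv.ofBijective T hTb).symm_apply_apply t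
  rw [this, eval_eq, eval_eq]
  obtain ⟨x, t', rfl⟩ := append_split t
  obtain ⟨y, z, rfl⟩ := append_split t'
  rw [eval_orth, eval_hyper, ev_pb, hT, ev_add, ev_add, ev_lc0 q u y hu huu, ev_lc0 q v z hv hvv,
    bl_add_right, bl_comm q (lc b x) (lc u y), bl_comm q (lc b x) (lc v z), bl_lc q u, bl_lc q v,
    bl_lc q u]
  have e1 : ∀ i, bl q (u i) (lc b x) = 0 := fun i => by rw [bl_comm]; exact (hbW x i).1
  have e2 : ∀ i, bl q (v i) (lc b x) = 0 := fun i => by rw [bl_comm]; exact (hbW x i).2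
  have e3 : ∀ i, bl q (u i) (lc v z) = z i := fun i => by
    rw [bl_comm, bl_lc]; simp [hvu]
  simp [e1, e2, e3]

lemma ws_tot {k w : ℕ} (q : QF F k) (h : w ∈ WS q) :
    ∃ j : (Fin w → F) →ₗ[F] (Fin k → F), Function.Injective j ∧ ∀ x, ev q (j x) = 0 := by
  obtain ⟨m, q', e, he⟩ := h
  let i : (Fin w → F) →ₗ[F] (Fin (m + (w + w)) → F) :=
    { toFun := fun x => Fin.append 0 (Fin.append x 0)
      map_add' := by
        intro x y
        funext i
        refine Fin.addCases (fun i => ?_) (fun i => ?_) i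
        · simp
        · refine Fin.addCases (fun i => ?_) (fun i => ?_) i <;> simp [-Fin.natAdd_eq_addNat]
      map_smul' := by
        intro c x
        funext i
        refine Fin.addCases (fun i => ?_) (fun i => ?_) i
        · simp
        · refine Fin.addCases (fun i => ?_) (fun i => ?_) i <;> simp [-Fin.natAdd_eq_addNat] }
  refine ⟨e.symm.toLinearMap.comp i, ?_, ?_⟩
  · rw [LinearMap.coe_comp]
    refine e.symm.injective.comp ?_
    intro x y hxy
    funext l
    have := congrFun hxy (Fin.natAdd m (Fin.castAdd w l))
    simpa [i] using this
  · intro x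
    rw [← eval_eq, ← he]
    simp only [LinearMap.comp_apply, LinearEquiv.coe_coe, LinearEquiv.apply_symm_apply]
    rw [eval_eq]
    change ev _ (Fin.append 0 (Fin.append x 0)) = 0
    rw [eval_orth, eval_hyper, ev_zero]; simp

lemma ws_bdd {k : ℕ} (q : QF F k) : BddAbove (WS q) := by
  refine ⟨k, fun w hw => ?_⟩
  obtain ⟨j, hj, -⟩ := ws_tot q hw
  simpa using LinearMap.finrank_le_finrank_of_injective hj

lemma ws_zero {k : ℕ} (q : QF F k) : 0 ∈ WS q :=
  hb_mem q (fun i => i.elim0) (fun i => i.elim0) (fun i => i.elim0) (fun i => i.elim0)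
    (fun i => i.elim0) (fun i => i.elim0) (fun i => i.elim0)

lemma wi_mem {k : ℕ} (q : QF F k) : QF.wittIndex q ∈ WS q :=
  Nat.sSup_mem ⟨0, ws_zero q⟩ (ws_bdd q)

lemma le_wi {k w : ℕ} (q : QF F k) (h : w ∈ WS q) : w ≤ QF.wittIndex q := le_csSup (ws_bdd q) h

lemma wi_zero {k : ℕ} (q : QF F k) (h : An q) : QF.wittIndex q = 0 := by
  obtain ⟨j, hj, hj0⟩ := ws_tot q (wi_mem q)
  by_contra hne
  have : (fun _ => 1 : Fin (QF.wittIndex q) → F) = 0 := by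
    apply hj
    rw [map_zero]
    exact h _ (hj0 _)
  have := congrFun this ⟨0, by omega⟩
  simp at this

lemma wi_nri {k : ℕ} (q : QF F k) (h2 : (2 : F) = 0) (h : NRI q) : 1 ≤ QF.wittIndex q := by
  obtain ⟨y, z, hy, hyz⟩ := h
  set β := bl q y z
  have hv : ev q (β⁻¹ • z + (- (β⁻¹ ^ 2 * ev q z)) • y) = 0 := by
    rw [ev_add, ev_smul, ev_smul, bl_smul_left, bl_smul_right, hy, bl_comm q z y]
    change _ + _ + β⁻¹ * (_ * β) = 0
    field_simp
    ring
  refine le_wi q (hb_mem q (fun _ : Fin 1 => y)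
    (fun _ => β⁻¹ • z + (- (β⁻¹ ^ 2 * ev q z)) • y) (fun _ => hy) (fun _ => hv) ?_ ?_ ?_)
  · intro i j; rw [bl_self, h2, zero_mul]
  · intro i j; rw [bl_self, h2, zero_mul]
  · intro i j
    rw [bl_add_right, bl_smul_right, bl_smul_right, bl_self, h2, zero_mul, mul_zero, add_zero,
      if_pos (Subsingleton.elim _ _)]
    exact inv_mul_cancel₀ hyz

lemma wi_sep {k r : ℕ} (q : QF F k) (h2 : (2 : F) = 0) [IsSepClosed F] (p p' : Fin r → Fin k → F)
    (hpp : ∀ i j, bl q (p i) (p j) = 0) (hpp' : ∀ i j, bl q (p' i) (p' j) = 0)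
    (h : ∀ i j, bl q (p i) (p' j) = if i = j then 1 else 0) : r ≤ QF.wittIndex q := by
  have h' : ∀ i j, bl q (p' i) (p j) = if i = j then 1 else 0 := by
    intro i j; rw [bl_comm, h]; simp [eq_comm]
  have ht : ∀ i, ∃ θ : F, ev q (p i) * θ ^ 2 + 1 * θ + ev q (p' i) = 0 := fun i =>
    IsSepClosed.exists_root_C_mul_X_pow_add_C_mul_X_add_C _ _ _ (by exact_mod_cast h2) le_rfl
      one_ne_zero
  choose θ hθ using ht
  let u : Fin r → Fin k → F := fun i => θ i • p i + p' i
  let v : Fin r → Fin k → F := fun i => p i + (- ev q (p i)) • u i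
  have hu : ∀ i, ev q (u i) = 0 := by
    intro i
    simp only [u]
    rw [ev_add, ev_smul, bl_smul_left, h, if_pos rfl, ← hθ i]; ring
  have huu : ∀ i j, bl q (u i) (u j) = 0 := by
    intro i j
    simp only [u, bl_add_left, bl_add_right, bl_smul_left, bl_smul_right, hpp, hpp', h, h']
    by_cases hij : i = j
    · subst hij; simp; linear_combination θ i * h2
    · simp [hij]
  have hup : ∀ i j, bl q (u i) (p j) = if i = j then 1 else 0 := by
    intro i j
    simp only [u, bl_add_left, bl_smul_left, hpp, h']; simp
  refine le_wi q (hb_mem q u v hu ?_ huu ?_ ?_)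
  · intro i
    simp only [v]
    rw [ev_add, ev_smul, hu, bl_smul_right, bl_comm, hup, if_pos rfl]; ring
  · intro i j
    simp only [v, bl_add_left, bl_add_right, bl_smul_left, bl_smul_right, hpp, hup, huu,
      bl_comm q (p i) (u j)]
    by_cases hij : i = j
    · subst hij; simp; linear_combination (- ev q (p i)) * h2
    · simp [hij, Ne.symm hij]
  · intro i j
    simp only [v, bl_add_right, bl_smul_right, huu, hup]; simp

end bridge

lemma type_basis {F : Type} [Field F] {k r s : ℕ} (h2 : (2 : F) = 0) (q : QF F k)
    (h : QF.HasType q r s) :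
    k = r + r + s ∧ ∃ p p' : Fin r → Fin k → F,
      (∀ i j, bl q (p i) (p j) = 0) ∧ (∀ i j, bl q (p' i) (p' j) = 0) ∧
      (∀ i j, bl q (p i) (p' j) = if i = j then 1 else 0) := by
  obtain ⟨c, a, b, e, he⟩ := h
  refine ⟨by simpa using e.finrank_eq, ?_⟩
  set Q := QF.orthSum (QF.binSum a b) (QF.diag c) with hQ
  have hb : ∀ x y, bl q (e.symm x) (e.symm y) = bl Q x y := by
    intro x y
    have h1 : ∀ t, ev q (e.symm t) = ev Q t := by
      intro t; rw [← eval_eq, ← he, e.apply_symm_apply, eval_eq]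
    have h3 := h1 (x + y)
    rw [map_add, ev_add, ev_add, h1, h1] at h3
    exact add_left_cancel h3
  have hB : ∀ x y x' y' : Fin r → F,
      bl Q (Fin.append (Fin.append x y) 0) (Fin.append (Fin.append x' y') 0) =
        ∑ i, (x i * y' i + x' i * y i) := by
    intro x y x' y'
    have h1 := ev_add Q (Fin.append (Fin.append x y) 0) (Fin.append (Fin.append x' y') 0)
    have h3 : (Fin.append (Fin.append x y) 0 + Fin.append (Fin.append x' y') 0 :
        Fin (r + r + s) → F) = Fin.append (Fin.append (x + x') (y + y')) 0 := by
      funext i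
      refine Fin.addCases (fun i => ?_) (fun i => ?_) i
      · refine Fin.addCases (fun i => ?_) (fun i => ?_) i <;> simp [-Fin.natAdd_eq_addNat]
      · simp
    rw [h3, hQ, eval_orth, eval_orth, eval_orth, ev_zero, eval_bin, eval_bin, eval_bin, add_zero,
      add_zero, add_zero, ← Finset.sum_add_distrib] at h1
    rw [← sub_eq_iff_eq_add', ← Finset.sum_sub_distrib] at h1
    rw [← h1]
    refine Finset.sum_congr rfl fun i _ => ?_
    simp only [Pi.add_apply]
    linear_combination (a i * x i * x' i + b i * y i * y' i) * h2
  refine ⟨fun i => e.symm (Fin.append (Fin.append (Pi.single i 1) 0) 0),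
    fun i => e.symm (Fin.append (Fin.append 0 (Pi.single i 1)) 0), ?_, ?_, ?_⟩
  · intro i j; rw [hb, hB]; simp
  · intro i j; rw [hb, hB]; simp
  · intro i j; rw [hb, hB]; simp [Pi.single_apply, eq_comm]

theorem main (F : Type) [Field F] [CharP F 2] {n m r s : ℕ}
    (q : QF F (2 ^ n + m)) (hm : 1 ≤ m) (hm' : m ≤ 2 ^ n)
    (hty : QF.HasType q r s) (hr : 1 ≤ r) (haniso : QF.Anisotropic q)
    (hrs : r + s ≤ 2 ^ n) (hh : QF.hnd q = 1) :
    2 ^ n + m = 2 ^ (n + 1) - s := by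
  have h2 : (2 : F) = 0 := CharTwo.two_eq_zero
  have han : An q := fun x hx => haniso x (by rw [eval_eq, hx])
  obtain ⟨hdim, p, p', hpp, hpp', hp⟩ := type_basis h2 q hty
  by_contra hne
  have hlt : r + s + 1 ≤ 2 ^ n := by rw [pow_succ] at hne; omega
  let i0 : Fin r := ⟨0, hr⟩
  have hz : bl q (p i0) (p' i0) ≠ 0 := by rw [hp]; simp
  have hc : ev q (p' i0) ≠ 0 := by
    intro h0
    rw [han _ h0, bl_zero_right] at hz
    exact hz rfl
  have hfact : Fact (Irreducible (gpol q (p' i0))) := ⟨gpol_irred h2 q han (p i0) (p' i0) hz hc⟩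
  let Kφ := GFd q (p' i0)
  -- the splitting pattern
  have m0 : 0 ∈ QF.splittingPattern q := by
    refine ⟨⟨F⟩, se_sep F F, ?_⟩
    refine wi_zero _ ?_
    change An (q.map (RingHom.id F))
    have : q.map (RingHom.id F) = q := by ext; rfl
    rw [this]; exact han
  have m1 : QF.wittIndex (q.map (cG q (p' i0))) ∈ QF.splittingPattern q :=
    ⟨⟨Kφ⟩, se_GF h2 q (p i0) (p' i0) hz, rfl⟩
  have m2 : QF.wittIndex (q.map (algebraMap F (SeparableClosure F))) ∈ QF.splittingPattern q :=
    ⟨⟨SeparableClosure F⟩, se_sep F _, rfl⟩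
  have w1 : 1 ≤ QF.wittIndex (q.map (cG q (p' i0))) :=
    wi_nri _ (two_map (cG q (p' i0)) h2) (GF_nri h2 q (p i0) (p' i0) hz)
  have w2 : r ≤ QF.wittIndex (q.map (algebraMap F (SeparableClosure F))) := by
    set f := algebraMap F (SeparableClosure F)
    refine wi_sep _ (two_map f h2) (fun i l => f (p i l)) (fun i l => f (p' i l)) ?_ ?_ ?_
    · intro i j; rw [bl_map, hpp, map_zero]
    · intro i j; rw [bl_map, hpp', map_zero]
    · intro i j; rw [bl_map, hp]; split_ifs <;> simp
  have hcard : (QF.splittingPattern q).ncard = 2 := by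
    unfold QF.hnd at hh; omega
  have hw : r ≤ QF.wittIndex (q.map (cG q (p' i0))) := by
    obtain ⟨x, y, -, hxy⟩ := Set.ncard_eq_two.1 hcard
    rw [hxy] at m0 m1 m2
    simp only [Set.mem_insert_iff, Set.mem_singleton_iff] at m0 m1 m2
    omega
  obtain ⟨j, hj, hj0⟩ := ws_tot _ (wi_mem (q.map (cG q (p' i0))))
  let v : ℕ → Fin (2 ^ n + m) → F := fun l i => if (i : ℕ) = l then 1 else 0
  have hv : LI (fun l : Fin (r + s + 1) => v l) := by
    intro x hx
    funext l
    have := congrFun hx ⟨l, by omega⟩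
    rw [lc_apply] at this
    simpa [v, Fin.val_inj] using this
  have hP : ¬ An ((pb q (fun l : Fin (r + s + 1) => v l)).map (cG q (p' i0))) := by
    rw [pb_map, an_iff_of_iso_not]
    have hk := ker_dim (lc (fun (l : Fin (r + s + 1)) i => cG q (p' i0) (v l i)))
      (LinearMap.range j)
    rw [LinearMap.finrank_range_of_inj hj] at hk
    simp only [Module.finrank_fintype_fun_eq_card, Fintype.card_fin] at hk
    have hpos : 0 < Module.finrank (GFd q (p' i0)) ((LinearMap.range j).comap
      (lc (fun (l : Fin (r + s + 1)) i => cG q (p' i0) (v l i)))) := by omega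
    have := Module.finrank_pos_iff.1 hpos
    obtain ⟨⟨c, hc'⟩, hcne⟩ := exists_ne (0 : (LinearMap.range j).comap
      (lc (fun (l : Fin (r + s + 1)) i => cG q (p' i0) (v l i))))
    refine ⟨c, fun h => hcne (Subtype.ext h), ?_⟩
    obtain ⟨x, hx⟩ := hc'
    rw [ev_pb, ← hx, hj0]
  refine final h2 q han v n (r + s + 1) hlt (by omega) hv (p i0) (p' i0) hz ?_
  intro K _ f hf
  obtain ⟨g, hg⟩ := GF_univ h2 q (p i0) (p' i0) hz hc K f hf
  have h3 := not_an_map g hP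
  rw [comp_map, hg, ← comp_map] at h3
  have h4 : ¬ An ((pb q (fun l : Fin (r + s + 1) => v l)).map f) := fun h => h3 (an_GR _ _ h)
  rw [pb_map, an_iff_of_iso_not] at h4
  obtain ⟨c, hc0, hc1⟩ := h4
  refine ⟨c, hc0, ?_⟩
  rw [ev_pb] at hc1
  exact hc1

end HS

/-- Corollary 9.5: let `φ` be an anisotropic quadratic form of type
`(r, s)` over a field `F` of characteristic 2 with `r ≥ 1`, `dim φ = 2 ^ n + m`
(`1 ≤ m ≤ 2 ^ n`) and `r + s ≤ 2 ^ n`.  If `φ` has nondefective height 1, then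
`dim φ = 2 ^ (n + 1) - s`. -/
theorem statement17 (F : Type) [Field F] [CharP F 2] {n m r s : ℕ}
    (q : QF F (2 ^ n + m)) (hm : 1 ≤ m) (hm' : m ≤ 2 ^ n)
    (hty : QF.HasType q r s) (hr : 1 ≤ r) (haniso : QF.Anisotropic q)
    (hrs : r + s ≤ 2 ^ n) (hh : QF.hnd q = 1) :
    2 ^ n + m = 2 ^ (n + 1) - s := by
  exact HS.main F q hm hm' hty hr haniso hrs hh
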